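/- arXiv:gr-qc/0004045 — 2 statements merged into one kernel-verified Lean document; each statement's English description precedes it below -/
import Mathlib

section
/- Let n = 4. A glueing datum of dimension n consists of: a finite nonempty index set I (indexing copies Δ_i of the standard n-simplex, realized as {x : {0,…,n} → [0,∞) | Σ_v x_v = 1}, with vertices labeled 0,…,n); a fixed-point-free involution P of the set I × {0,…,n} of codimension-1 faces, where (i,k) denotes the face {x ∈ Δ_i | x_k = 0}; and, for each face (i,k) with P(i,k) = (j,l), a bijection φ_{(i,k)} : {0,…,n}∖{k} → {0,…,n}∖{l}, subject to φ_{(j,l)} = φ_{(i,k)}⁻¹. Suppose that condition Ori holds: there exists ε : I → {+1,−1} such that for every face (i,k) with P(i,k) = (j,l) one has ε(i)·(−1)^k·sgn(φ_{(i,k)}) = −ε(j)·(−1)^l, where sgn(φ_{(i,k)}) is the signature of the permutation of {1,…,n} obtained by conjugating φ_{(i,k)} with the order-preserving bijections {0,…,n}∖{k} → {1,…,n} and {0,…,n}∖{l} → {1,…,n}. Suppose moreover that condition Surf holds: for each i ∈ I and each 2-element subset {a,b} of {0,…,4}, take a copy T_i(a,b) of the standard 2-simplex with its three vertices labeled by the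 three elements of {0,…,4}∖{a,b}; each face (i,k) with P(i,k) = (j,l) and φ = φ_{(i,k)} induces, for every 2-element subset {a,b} of {0,…,4}∖{k}, the affine identification of the edge of T_i(a,b) with endpoints labeled by the two elements c,d of {0,…,4}∖{k,a,b} with the edge of T_j(φ(a),φ(b)) with endpoints labeled φ(c), φ(d), matching the vertex labeled c to the one labeled φ(c) and the vertex labeled d to the one labeled φ(d); letting Σ be the quotient of the disjoint union of all the triangles T_i(a,b) by these identifications with the quotient topology, condition Surf requires every connected component of Σ to be homeomorphic to the 2-sphere S² (the unit sphere in ℝ³). Then condition Dir holds: there exist relations o_i on {0,…,4} (one for each i ∈ I) such that for all a ≠ b exactly one of o_i(a,b), o_i(b,a) holds, and for every face (i,k) with P(i,k) = (j,l) and all a, b ∈ {0,…,4}∖{k} with a ≠ b one has o_i(a,b) ↔ o_j(φ_{(i,k)}(a), φ_{(i,k)}(b)). -/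
open scoped Classical

noncomputable section

/-- A glueing datum of dimension `n`: a finite nonempty set `I` indexing copies of the
standard `n`-simplex, a fixed-point-free involution `P` of the set `I × Fin (n+1)` of
codimension-1 faces (the face `(i,k)` of the `i`-th simplex being opposite to the vertex
`k`), and for each face `(i,k)` with `P (i,k) = (j,l)` a simplicial identification,
encoded as a permutation `glue (i,k)` of the vertex labels sending `k` to `l` (its
restriction to `{0,…,n} \ {k}` is the bijection `φ_{(i,k)}` onto `{0,…,n} \ {l}`),
subject to `φ_{P f} = (φ f)⁻¹`. -/
structure GlueingDatum (n : ℕ) where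
  I : Type
  fintypeI : Fintype I
  nonemptyI : Nonempty I
  P : I × Fin (n + 1) → I × Fin (n + 1)
  P_involutive : ∀ f, P (P f) = f
  P_fixedPointFree : ∀ f, P f ≠ f
  glue : I × Fin (n + 1) → Equiv.Perm (Fin (n + 1))
  glue_face : ∀ f, glue f f.2 = (P f).2
  glue_symm : ∀ f, glue (P f) = (glue f).symm

/-- The permutation of `Fin n` obtained from a permutation `e` of `Fin (n+1)` by
deleting `k` from the source and `e k` from the target, conjugating by the
order-preserving bijections `{0,…,n} \ {k} ≃ {1,…,n}` and `{0,…,n} \ {e k} ≃ {1,…,n}`. -/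
def restrictPerm {n : ℕ} (e : Equiv.Perm (Fin (n + 1))) (k : Fin (n + 1)) :
    Equiv.Perm (Fin n) :=
  (finSuccAboveEquiv k).trans
    ((e.subtypeEquiv (fun _ => (not_congr e.apply_eq_iff_eq).symm)).trans
      (finSuccAboveEquiv (e k)).symm)

/-- The signature of the face-pairing `e` at the face opposite to `k`. -/
def glueSign {n : ℕ} (e : Equiv.Perm (Fin (n + 1))) (k : Fin (n + 1)) : ℤˣ :=
  Equiv.Perm.sign (restrictPerm e k)

/-- Condition Ori: the simplices can be given signs so that every face-pairing
reverses the induced orientation. -/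
def Ori {n : ℕ} (D : GlueingDatum n) : Prop :=
  ∃ ε : D.I → ℤˣ, ∀ (i : D.I) (k : Fin (n + 1)),
    ε i * (-1) ^ (k : ℕ) * glueSign (D.glue (i, k)) k
      = -(ε (D.P (i, k)).1 * (-1) ^ (((D.P (i, k)).2 : Fin (n + 1)) : ℕ))

/-- Condition Dir: the edges of the simplices can be directed compatibly with all the
face-pairings. -/
def Dir {n : ℕ} (D : GlueingDatum n) : Prop :=
  ∃ o : D.I → Fin (n + 1) → Fin (n + 1) → Prop,
    (∀ i a b, a ≠ b → Xor' (o i a b) (o i b a)) ∧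
    (∀ (i : D.I) (k a b : Fin (n + 1)), a ≠ k → b ≠ k → a ≠ b →
      (o i a b ↔ o (D.P (i, k)).1 (D.glue (i, k) a) (D.glue (i, k) b)))

/-- The triangle `T_i(a,b)` (for `s = {a,b}`), realized in barycentric coordinates on
`Fin 5` supported on the complement of `s`: its three vertices are labeled by the three
elements of `{0,…,4} \ s`. -/
abbrev LabTri (s : Finset (Fin 5)) : Type :=
  {x : Fin 5 → ℝ // (∀ v, 0 ≤ x v) ∧ (∑ v, x v = 1) ∧ ∀ v ∈ s, x v = 0}

/-- The disjoint union of the triangles `T_i(a,b)` over all `i ∈ I` and all 2-element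
subsets `{a,b}` of `{0,…,4}`. -/
abbrev SurfTotal (D : GlueingDatum 4) : Type :=
  Σ p : D.I × {s : Finset (Fin 5) // s.card = 2}, LabTri p.2.1

/-- The edge identifications induced by the face-pairings: for a face `(i,k)` with
`P (i,k) = (j,l)` and `φ = φ_{(i,k)}`, and a 2-element subset `s ⊆ {0,…,4} \ {k}`, the
edge of `T_i(s)` with endpoints labeled by the two elements of `{0,…,4} \ (s ∪ {k})`
(i.e. the points with `x k = 0`) is identified with the corresponding edge of
`T_j(φ(s))` by `y = x ∘ φ⁻¹`, which matches each endpoint label `c` with `φ(c)`. -/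
def surfRel (D : GlueingDatum 4) : SurfTotal D → SurfTotal D → Prop := fun p q =>
  ∃ k : Fin 5, k ∉ p.1.2.1 ∧ p.2.1 k = 0 ∧
    (D.P (p.1.1, k)).1 = q.1.1 ∧
    q.1.2.1 = p.1.2.1.image (⇑(D.glue (p.1.1, k))) ∧
    (q.2.1 : Fin 5 → ℝ) = p.2.1 ∘ ⇑(D.glue (p.1.1, k)).symm

/-- The closed surface `Σ(S,P)` associated to the glueing datum, with the quotient
topology. -/
abbrev SurfSpace (D : GlueingDatum 4) : Type := Quot (surfRel D)

/-- Condition Surf: every connected component of the surface `Σ(S,P)` is homeomorphic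
to the 2-sphere (the unit sphere in ℝ³). -/
def Surf (D : GlueingDatum 4) : Prop :=
  ∀ z : SurfSpace D,
    Nonempty (↥(connectedComponent z) ≃ₜ
      ↥(Metric.sphere (0 : EuclideanSpace ℝ (Fin 3)) 1))

theorem chart_lift {E X : Type*} [TopologicalSpace E] [TopologicalSpace X] {p : E → X}
    (cov : IsCoveringMap p)
    (f : C(Metric.sphere (0 : EuclideanSpace ℝ (Fin 3)) 1, X))
    (v u : Metric.sphere (0 : EuclideanSpace ℝ (Fin 3)) 1) (hu : u ≠ v) (e : E)
    (he : p e = f u) :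
    ∃ F : Metric.sphere (0 : EuclideanSpace ℝ (Fin 3)) 1 → E,
      ContinuousOn F {v}ᶜ ∧ (∀ w, w ≠ v → p (F w) = f w) ∧ F u = e := by
  have : Fact (Module.finrank ℝ (EuclideanSpace ℝ (Fin 3)) = 2 + 1) := ⟨by simp⟩
  let c := stereographic' 2 v
  have hs : c.source = {v}ᶜ := stereographic'_source v
  have ht : c.target = Set.univ := stereographic'_target v
  have hcont : Continuous c.symm := by
    have h := c.continuousOn_symm
    rw [ht] at h
    exact continuousOn_univ.mp h
  have hus : u ∈ c.source := by rw [hs]; exact hu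
  obtain ⟨H, ⟨H0, H1⟩, -⟩ := cov.existsUnique_continuousMap_lifts
    (f.comp ⟨c.symm, hcont⟩) (c u) e (by simp [c.left_inv hus, he])
  refine ⟨H ∘ c, ?_, ?_, H0⟩
  · have h := H.continuous.comp_continuousOn c.continuousOn
    rwa [hs] at h
  · intro w hw
    have hws : w ∈ c.source := by rw [hs]; exact hw
    have h := congrFun H1 (c w)
    simpa [c.left_inv hws] using h

theorem sphere_inter_preconnected (v : Metric.sphere (0 : EuclideanSpace ℝ (Fin 3)) 1) :
    IsPreconnected ({v}ᶜ ∩ {-v}ᶜ : Set (Metric.sphere (0 : EuclideanSpace ℝ (Fin 3)) 1)) := by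
  have : Fact (Module.finrank ℝ (EuclideanSpace ℝ (Fin 3)) = 2 + 1) := ⟨by simp⟩
  let c := stereographic' 2 v
  have hs : c.source = {v}ᶜ := stereographic'_source v
  have ht : c.target = Set.univ := stereographic'_target v
  have hcont : Continuous c.symm := by
    have h := c.continuousOn_symm
    rw [ht] at h
    exact continuousOn_univ.mp h
  have hvs : -v ∈ c.source := by
    rw [hs]
    exact fun h => ne_neg_of_mem_unit_sphere ℝ v h.symm
  have hr : 1 < Module.rank ℝ (EuclideanSpace ℝ (Fin 2)) := by
    rw [← Module.finrank_eq_rank]; simp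
  have hc := ((isConnected_compl_singleton_of_one_lt_rank hr (c (-v))).image c.symm
    hcont.continuousOn).isPreconnected
  convert! hc using 1
  ext w
  constructor
  · rintro ⟨h1, h2⟩
    have hws : w ∈ c.source := by rw [hs]; exact h1
    refine ⟨c w, fun h => h2 ?_, c.left_inv hws⟩
    exact c.injOn hws hvs h
  · rintro ⟨y, hy, rfl⟩
    have hyt : y ∈ c.target := by rw [ht]; trivial
    refine ⟨by rw [← hs]; exact c.map_target hyt, fun h => hy ?_⟩
    have h' : c.symm y = -v := h
    show y = c (-v)
    rw [← h', c.right_inv hyt]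

/-- Maps from the 2-sphere lift through covering maps. -/
theorem sphere_lift {E X : Type*} [TopologicalSpace E] [TopologicalSpace X] {p : E → X}
    (cov : IsCoveringMap p) (hp : Function.Surjective p)
    (f : C(Metric.sphere (0 : EuclideanSpace ℝ (Fin 3)) 1, X)) :
    ∃ F : Metric.sphere (0 : EuclideanSpace ℝ (Fin 3)) 1 → E,
      Continuous F ∧ ∀ w, p (F w) = f w := by
  let v : Metric.sphere (0 : EuclideanSpace ℝ (Fin 3)) 1 :=
    ⟨EuclideanSpace.single 0 1, by simp⟩
  let u : Metric.sphere (0 : EuclideanSpace ℝ (Fin 3)) 1 :=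
    ⟨EuclideanSpace.single 1 1, by simp⟩
  have huv : u ≠ v := by
    intro h
    have h1 := congrArg (fun z : Metric.sphere (0 : EuclideanSpace ℝ (Fin 3)) 1 => z.1 1) h
    simp [u, v] at h1
  have huv' : u ≠ -v := by
    intro h
    have h1 := congrArg (fun z : Metric.sphere (0 : EuclideanSpace ℝ (Fin 3)) 1 => z.1 1) h
    simp [u, v] at h1
  have hvv : v ≠ -v := ne_neg_of_mem_unit_sphere ℝ v
  obtain ⟨e, he⟩ := hp (f u)
  obtain ⟨F, F1, F2, F3⟩ := chart_lift cov f v u huv e he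
  obtain ⟨G, G1, G2, G3⟩ := chart_lift cov f (-v) u huv' e he
  have hFG : Set.EqOn F G ({v}ᶜ ∩ {-v}ᶜ) :=
    cov.eqOn_of_comp_eqOn (sphere_inter_preconnected v) (F1.mono Set.inter_subset_left)
      (G1.mono Set.inter_subset_right)
      (fun w hw => by simp only [Function.comp]; rw [F2 w hw.1, G2 w hw.2])
      (a := u) ⟨huv, huv'⟩ (F3.trans G3.symm)
  let H : Metric.sphere (0 : EuclideanSpace ℝ (Fin 3)) 1 → E := fun w => if w = v then G w else F w
  have HF : ∀ w, w ≠ v → H w = F w := fun w hw => if_neg hw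
  have HG : ∀ w, w ≠ -v → H w = G w := by
    intro w hw
    by_cases h : w = v
    · exact if_pos h
    · rw [HF w h]; exact hFG ⟨h, hw⟩
  refine ⟨H, continuous_iff_continuousAt.mpr fun w => ?_, fun w => ?_⟩
  · by_cases h : w = v
    · have hw : w ∈ ({-v}ᶜ : Set _) := by rw [h]; exact hvv
      have hn : ({-v}ᶜ : Set _) ∈ nhds w := isOpen_compl_singleton.mem_nhds hw
      exact (G1.continuousAt hn).congr (Filter.mem_of_superset hn fun z hz => (HG z hz).symm)
    · have hn : ({v}ᶜ : Set _) ∈ nhds w := isOpen_compl_singleton.mem_nhds h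
      exact (F1.continuousAt hn).congr (Filter.mem_of_superset hn fun z hz => (HF z hz).symm)
  · by_cases h : w = v
    · rw [HG w (by rw [h]; exact hvv), G2 w (by rw [h]; exact hvv)]
    · rw [HF w h, F2 w h]

theorem sign_eq_glueSign {n : ℕ} (e : Equiv.Perm (Fin (n + 1))) (k : Fin (n + 1)) :
    Equiv.Perm.sign e = (-1) ^ ((e k : Fin (n+1)) : ℕ) * glueSign e k * (-1) ^ (k : ℕ) := by
  have h : e = (Fin.cycleRange (e k)).symm * Equiv.Perm.decomposeFin.symm (0, restrictPerm e k)
      * Fin.cycleRange k := by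
    have h2 : e * (Fin.cycleRange k).symm =
      (Fin.cycleRange (e k)).symm * Equiv.Perm.decomposeFin.symm (0, restrictPerm e k) := by
      ext j
      refine Fin.cases ?_ (fun j => ?_) j
      · simp
      · simp only [Equiv.Perm.mul_apply, Fin.cycleRange_symm_succ,
          Equiv.Perm.decomposeFin_symm_apply_succ, Equiv.swap_self, Equiv.refl_apply]
        have h3 := congrArg Subtype.val ((finSuccAboveEquiv (e k)).apply_symm_apply
          (e.subtypeEquiv (fun _ => (not_congr e.apply_eq_iff_eq).symm) (finSuccAboveEquiv k j)))
        exact congrArg Fin.val h3.symm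
    rw [← h2]
    ext j
    simp
  conv_lhs => rw [h]
  rw [map_mul, map_mul, Equiv.Perm.sign_symm, Fin.sign_cycleRange, Fin.sign_cycleRange,
    Equiv.Perm.decomposeFin.symm_sign]
  simp [glueSign]

theorem ori_sign (D : GlueingDatum 4) (ε : D.I → ℤˣ)
    (hε : ∀ (i : D.I) (k : Fin 5),
    ε i * (-1) ^ (k : ℕ) * glueSign (D.glue (i, k)) k
      = -(ε (D.P (i, k)).1 * (-1) ^ (((D.P (i, k)).2 : Fin 5) : ℕ))) (i : D.I) (k : Fin 5) :
    ε (D.P (i, k)).1 = - (ε i * Equiv.Perm.sign (D.glue (i, k))) := by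
  have h := hε i k
  rw [sign_eq_glueSign _ k, D.glue_face (i, k)]
  set a := ε (D.P (i, k)).1
  set s := ((-1 : ℤˣ)) ^ (((D.P (i, k)).2 : Fin 5) : ℕ)
  set t := ((-1 : ℤˣ)) ^ (k : ℕ)
  set g := glueSign (D.glue (i, k)) k
  have hs : s * s = 1 := Int.units_mul_self s
  calc a = a * (s * s) := by rw [hs, mul_one]
    _ = - (-(a * s)) * s := by rw [neg_neg, mul_assoc]
    _ = _ := by rw [← h, neg_mul]; congr 1; simp only [mul_comm, mul_left_comm, mul_assoc]

/-- Abstract dihedral argument. -/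
theorem dihedral_free {S : Type*} (F r : Equiv.Perm S) (hF : r * F = F⁻¹ * r)
    (h1 : ∀ y, r y ≠ y) (h2 : ∀ y, r y ≠ F y) (n : ℤ) (y : S) : (F ^ n) y ≠ r y := by
  have hz : ∀ m : ℤ, r * F ^ m = F ^ (-m) * r := by
    intro m
    have hc : SemiconjBy r F F⁻¹ := hF
    have := hc.zpow_right m
    rw [inv_zpow'] at this
    exact this
  intro h
  obtain ⟨m, hm | hm⟩ := Int.even_or_odd' n
  · apply h1 ((F ^ m) y)
    rw [← Equiv.Perm.mul_apply, hz, Equiv.Perm.mul_apply, ← h, ← Equiv.Perm.mul_apply, ← zpow_add]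
    congr 2; omega
  · apply h2 ((F ^ m) y)
    rw [← Equiv.Perm.mul_apply, hz, Equiv.Perm.mul_apply, ← h, ← Equiv.Perm.mul_apply, ← zpow_add,
      ← Equiv.Perm.mul_apply, ← zpow_one_add]
    congr 2; omega

theorem perm5_eq_one : ∀ ρ : Equiv.Perm (Fin 5), ρ 0 = 0 → ρ 1 = 1 → ρ 2 = 2 →
    Equiv.Perm.sign ρ = 1 → ρ = 1 := by
  intro ρ h0 h1 h2 hs
  have hne : ∀ x y : Fin 5, x ≠ y → ρ x ≠ ρ y := fun x y h h' => h (ρ.injective h')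
  have a0 := hne 3 0 (by decide)
  have a1 := hne 3 1 (by decide)
  have a2 := hne 3 2 (by decide)
  have b0 := hne 4 0 (by decide)
  have b1 := hne 4 1 (by decide)
  have b2 := hne 4 2 (by decide)
  have b3 := hne 4 3 (by decide)
  have h34 : (ρ 3 = 3 ∧ ρ 4 = 4) ∨ (ρ 3 = 4 ∧ ρ 4 = 3) := by
    rw [h0] at a0 b0
    rw [h1] at a1 b1
    rw [h2] at a2 b2
    omega
  rcases h34 with ⟨h3, h4⟩ | ⟨h3, h4⟩
  · ext j
    fin_cases j <;> simp [h0, h1, h2, h3, h4]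
  · have : ρ = Equiv.swap 3 4 := by
      ext j
      fin_cases j
      · exact congrArg Fin.val h0
      · exact congrArg Fin.val h1
      · exact congrArg Fin.val h2
      · exact congrArg Fin.val h3
      · exact congrArg Fin.val h4
    rw [this, Equiv.Perm.sign_swap (by decide)] at hs
    exact absurd hs (by decide)

/-- States: a simplex with an ordering of its vertices. Cross the face opposite to the
last vertex. -/
def crossLast (D : GlueingDatum 4) (s : D.I × Equiv.Perm (Fin 5)) : D.I × Equiv.Perm (Fin 5) :=
  ((D.P (s.1, s.2 4)).1, D.glue (s.1, s.2 4) * s.2 * Equiv.swap 3 4)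

def crossPrev (D : GlueingDatum 4) (s : D.I × Equiv.Perm (Fin 5)) : D.I × Equiv.Perm (Fin 5) :=
  ((D.P (s.1, s.2 3)).1, D.glue (s.1, s.2 3) * s.2 * Equiv.swap 3 4)

theorem P_mk (D : GlueingDatum 4) (i : D.I) (k : Fin 5) :
    ((D.P (i, k)).1, D.glue (i, k) k) = D.P (i, k) := by
  have := D.glue_face (i, k)
  rw [show D.glue (i, k) k = (D.P (i, k)).2 from this]

theorem P_back (D : GlueingDatum 4) (i : D.I) (k : Fin 5) :
    D.P ((D.P (i, k)).1, D.glue (i, k) k) = (i, k) := by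
  rw [P_mk, D.P_involutive]

theorem glue_back (D : GlueingDatum 4) (i : D.I) (k : Fin 5) :
    D.glue ((D.P (i, k)).1, D.glue (i, k) k) = (D.glue (i, k)).symm := by
  rw [P_mk, D.glue_symm]

theorem crossPrev_crossLast (D : GlueingDatum 4) (s) : crossPrev D (crossLast D s) = s := by
  obtain ⟨i, π⟩ := s
  have h3 : (D.glue (i, π 4) * π * Equiv.swap 3 4 : Equiv.Perm (Fin 5)) 3 = D.glue (i, π 4) (π 4) := by
    simp [Equiv.Perm.mul_apply]
  simp only [crossPrev, crossLast, h3, P_back, glue_back]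
  refine Prod.ext rfl ?_
  ext j
  simp [Equiv.Perm.mul_apply]

theorem crossLast_crossPrev (D : GlueingDatum 4) (s) : crossLast D (crossPrev D s) = s := by
  obtain ⟨i, π⟩ := s
  have h3 : (D.glue (i, π 3) * π * Equiv.swap 3 4 : Equiv.Perm (Fin 5)) 4 = D.glue (i, π 3) (π 3) := by
    simp [Equiv.Perm.mul_apply]
  simp only [crossPrev, crossLast, h3, P_back, glue_back]
  refine Prod.ext rfl ?_
  ext j
  simp [Equiv.Perm.mul_apply]

def crossPerm (D : GlueingDatum 4) : Equiv.Perm (D.I × Equiv.Perm (Fin 5)) where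
  toFun := crossLast D
  invFun := crossPrev D
  left_inv := crossPrev_crossLast D
  right_inv := crossLast_crossPrev D

def revPerm (D : GlueingDatum 4) : Equiv.Perm (D.I × Equiv.Perm (Fin 5)) where
  toFun s := (s.1, s.2 * (Equiv.swap 0 1 * Equiv.swap 3 4))
  invFun s := (s.1, s.2 * (Equiv.swap 0 1 * Equiv.swap 3 4))
  left_inv s := by
    refine Prod.ext rfl ?_
    show s.2 * _ * _ = s.2
    rw [mul_assoc, show (Equiv.swap (0 : Fin 5) 1 * Equiv.swap 3 4) *
      (Equiv.swap (0 : Fin 5) 1 * Equiv.swap 3 4) = 1 by decide, mul_one]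
  right_inv s := by
    refine Prod.ext rfl ?_
    show s.2 * _ * _ = s.2
    rw [mul_assoc, show (Equiv.swap (0 : Fin 5) 1 * Equiv.swap 3 4) *
      (Equiv.swap (0 : Fin 5) 1 * Equiv.swap 3 4) = 1 by decide, mul_one]

theorem no_self_glue (D : GlueingDatum 4) (i : D.I) (k : Fin 5) (h1 : (D.P (i, k)).1 = i)
    (h2 : D.glue (i, k) k = k) : False := by
  apply D.P_fixedPointFree (i, k)
  rw [← P_mk, h1, h2]

theorem cross_rev_free (D : GlueingDatum 4) (n : ℤ) (y) :
    (crossPerm D ^ n) y ≠ revPerm D y := by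
  apply dihedral_free
  · ext s : 1
    obtain ⟨i, π⟩ := s
    show revPerm D (crossLast D (i, π)) = crossPrev D (revPerm D (i, π))
    have h3 : (π * (Equiv.swap 0 1 * Equiv.swap 3 4) : Equiv.Perm (Fin 5)) 3 = π 4 := by
      simp only [Equiv.Perm.mul_apply]; congr 1
    simp only [revPerm, Equiv.coe_fn_mk, crossLast, crossPrev, h3]
    refine Prod.ext rfl ?_
    show _ * _ * _ * _ = _ * (_ * _) * _
    simp only [mul_assoc]
    congr 2
    decide
  · rintro ⟨i, π⟩ h
    have h2 := congrArg (fun s : D.I × Equiv.Perm (Fin 5) => s.2 0) h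
    have h4 : π 1 = π 0 := h2
    exact absurd (π.injective h4) (by decide)
  · rintro ⟨i, π⟩ h
    have h1 : i = (D.P (i, π 4)).1 := congrArg Prod.fst h
    have h2 := congrArg (fun s : D.I × Equiv.Perm (Fin 5) => s.2 3) h
    have h4 : π 4 = D.glue (i, π 4) (π 4) := by
      have e1 : (π * (Equiv.swap 0 1 * Equiv.swap 3 4) : Equiv.Perm (Fin 5)) 3 = π 4 := by
        simp only [Equiv.Perm.mul_apply]; congr 1
      have e2 : (D.glue (i, π 4) * π * Equiv.swap 3 4 : Equiv.Perm (Fin 5)) 3 = D.glue (i, π 4) (π 4) := by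
        simp [Equiv.Perm.mul_apply]
      exact e1.symm.trans (h2.trans e2)
    exact no_self_glue D i (π 4) h1.symm h4.symm

/-- Combinatorial labels: a simplex, an ordered pair of vertices, and a set of further vertices
(a face of the corresponding directed triangle). -/
abbrev DirLab (D : GlueingDatum 4) : Type := D.I × Fin 5 × Fin 5 × Finset (Fin 5)

def labCross (D : GlueingDatum 4) (k : Fin 5) (x : DirLab D) : DirLab D :=
  ((D.P (x.1, k)).1, D.glue (x.1, k) x.2.1, D.glue (x.1, k) x.2.2.1,
    x.2.2.2.image (D.glue (x.1, k)))

def labStep (D : GlueingDatum 4) (x y : DirLab D) : Prop :=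
  ∃ k, k ≠ x.2.1 ∧ k ≠ x.2.2.1 ∧ k ∉ x.2.2.2 ∧ y = labCross D k x

theorem labCross_back (D : GlueingDatum 4) (k : Fin 5) (x : DirLab D) :
    labCross D (D.glue (x.1, k) k) (labCross D k x) = x := by
  obtain ⟨i, a, b, S⟩ := x
  simp only [labCross, P_back, glue_back, Equiv.symm_apply_apply, Finset.image_image]
  simp

theorem labStep_symm (D : GlueingDatum 4) (x y : DirLab D) (h : labStep D x y) :
    labStep D y x := by
  obtain ⟨k, h1, h2, h3, rfl⟩ := h
  refine ⟨D.glue (x.1, k) k, ?_, ?_, ?_, (labCross_back D k x).symm⟩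
  · simpa [labCross] using h1
  · simpa [labCross] using h2
  · simpa [labCross] using h3

theorem labStep_card (D : GlueingDatum 4) (x y : DirLab D)
    (h : Relation.ReflTransGen (labStep D) x y) : y.2.2.2.card = x.2.2.2.card := by
  induction h with
  | refl => rfl
  | tail _ h ih =>
    obtain ⟨k, -, -, -, rfl⟩ := h
    rw [← ih]
    exact Finset.card_image_of_injective _ (Equiv.injective _)

theorem exists_perm5 (a b c : Fin 5) (hab : a ≠ b) (hac : a ≠ c) (hbc : b ≠ c) :
    ∃ π : Equiv.Perm (Fin 5), π 0 = a ∧ π 1 = b ∧ π 2 = c := by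
  have hcard : ((({a, b, c} : Finset (Fin 5))ᶜ).card) = 2 := by
    rw [Finset.card_compl, Finset.card_eq_three.mpr ⟨a, b, c, hab, hac, hbc, rfl⟩]; rfl
  obtain ⟨d, e, hde, hs⟩ := Finset.card_eq_two.mp hcard
  have hd : d ∈ (({a, b, c} : Finset (Fin 5))ᶜ) := by rw [hs]; simp
  have he : e ∈ (({a, b, c} : Finset (Fin 5))ᶜ) := by rw [hs]; simp
  simp only [Finset.mem_compl, Finset.mem_insert, Finset.mem_singleton, not_or] at hd he
  have hinj : Function.Injective ![a, b, c, d, e] := by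
    intro x y hxy
    obtain ⟨d1, d2, d3⟩ := hd
    obtain ⟨e1, e2, e3⟩ := he
    fin_cases x <;> fin_cases y <;> simp at hxy ⊢ <;> grind
  exact ⟨Equiv.ofBijective _ (Finite.injective_iff_bijective.mp hinj), rfl, rfl, rfl⟩

theorem exists_perm5_sign (a b c : Fin 5) (hab : a ≠ b) (hac : a ≠ c) (hbc : b ≠ c) (u : ℤˣ) :
    ∃ π : Equiv.Perm (Fin 5), π 0 = a ∧ π 1 = b ∧ π 2 = c ∧ u * Equiv.Perm.sign π = 1 := by
  obtain ⟨π, h0, h1, h2⟩ := exists_perm5 a b c hab hac hbc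
  by_cases h : u * Equiv.Perm.sign π = 1
  · exact ⟨π, h0, h1, h2, h⟩
  · refine ⟨π * Equiv.swap 3 4, ?_, ?_, ?_, ?_⟩
    · rw [← h0]; rfl
    · rw [← h1]; rfl
    · rw [← h2]; rfl
    · rw [map_mul, Equiv.Perm.sign_swap (by decide), ← mul_assoc,
        (Int.units_eq_one_or _).resolve_left h]; decide

def stLab (D : GlueingDatum 4) (s : D.I × Equiv.Perm (Fin 5)) : DirLab D :=
  (s.1, s.2 0, s.2 1, {s.2 2})

theorem vertex_free (D : GlueingDatum 4) (ε : D.I → ℤˣ)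
    (hε : ∀ i k, ε (D.P (i, k)).1 = - (ε i * Equiv.Perm.sign (D.glue (i, k))))
    (i : D.I) (a b c : Fin 5) (hab : a ≠ b) (hac : a ≠ c) (hbc : b ≠ c) :
    ¬ Relation.ReflTransGen (labStep D) (i, a, b, {c}) (i, b, a, {c}) := by
  intro hR
  obtain ⟨π, h0, h1, h2, hs⟩ := exists_perm5_sign a b c hab hac hbc (ε i)
  have hpos : ∀ s : D.I × Equiv.Perm (Fin 5), ε s.1 * Equiv.Perm.sign s.2 = 1 →
      ε (crossPerm D s).1 * Equiv.Perm.sign (crossPerm D s).2 = 1 := by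
    rintro ⟨j, ρ⟩ h
    show ε (D.P (j, ρ 4)).1 * Equiv.Perm.sign (D.glue (j, ρ 4) * ρ * Equiv.swap 3 4) = 1
    rw [hε, map_mul, map_mul, Equiv.Perm.sign_swap (by decide)]
    simp only at h
    refine Eq.trans ?_ h
    have := Int.units_mul_self (Equiv.Perm.sign (D.glue (j, ρ 4)))
    calc _ = ε j * (Equiv.Perm.sign (D.glue (j, ρ 4)) * Equiv.Perm.sign (D.glue (j, ρ 4)))
          * Equiv.Perm.sign ρ := by
            simp only [mul_neg, neg_mul, neg_neg, mul_one, mul_assoc]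
      _ = _ := by rw [this, mul_one]
  have hpos' : ∀ s : D.I × Equiv.Perm (Fin 5), ε s.1 * Equiv.Perm.sign s.2 = 1 →
      ε ((crossPerm D)⁻¹ s).1 * Equiv.Perm.sign ((crossPerm D)⁻¹ s).2 = 1 := by
    rintro ⟨j, ρ⟩ h
    show ε (D.P (j, ρ 3)).1 * Equiv.Perm.sign (D.glue (j, ρ 3) * ρ * Equiv.swap 3 4) = 1
    rw [hε, map_mul, map_mul, Equiv.Perm.sign_swap (by decide)]
    simp only at h
    refine Eq.trans ?_ h
    have := Int.units_mul_self (Equiv.Perm.sign (D.glue (j, ρ 3)))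
    calc _ = ε j * (Equiv.Perm.sign (D.glue (j, ρ 3)) * Equiv.Perm.sign (D.glue (j, ρ 3)))
          * Equiv.Perm.sign ρ := by
            simp only [mul_neg, neg_mul, neg_neg, mul_one, mul_assoc]
      _ = _ := by rw [this, mul_one]
  have key : ∀ y, Relation.ReflTransGen (labStep D) (i, a, b, {c}) y →
      ∃ n : ℤ, y = stLab D ((crossPerm D ^ n) (i, π)) ∧
        ε ((crossPerm D ^ n) (i, π)).1 * Equiv.Perm.sign ((crossPerm D ^ n) (i, π)).2 = 1 := by
    intro y hy
    induction hy with
    | refl => exact ⟨0, by simp [stLab, h0, h1, h2], hs⟩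
    | tail _ h ih =>
      obtain ⟨n, rfl, hn⟩ := ih
      obtain ⟨k, k0, k1, k2, rfl⟩ := h
      set s := (crossPerm D ^ n) (i, π) with hsdef
      obtain ⟨j, ρ⟩ := s
      simp only [stLab, Finset.mem_singleton] at k0 k1 k2
      obtain ⟨m, rfl⟩ := ρ.surjective k
      have hm : m = 3 ∨ m = 4 := by
        have m0 : m ≠ 0 := fun h => k0 (by rw [h])
        have m1 : m ≠ 1 := fun h => k1 (by rw [h])
        have m2 : m ≠ 2 := fun h => k2 (by rw [h])
        omega
      rcases hm with rfl | rfl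
      · refine ⟨-1 + n, ?_⟩
        rw [zpow_add, Equiv.Perm.mul_apply, ← hsdef, zpow_neg_one]
        refine ⟨?_, hpos' _ hn⟩
        show labCross D (ρ 3) (stLab D (j, ρ)) = stLab D (crossPrev D (j, ρ))
        simp only [labCross, stLab, crossPrev, Finset.image_singleton]
        rfl
      · refine ⟨1 + n, ?_⟩
        rw [zpow_add, Equiv.Perm.mul_apply, ← hsdef, zpow_one]
        refine ⟨?_, hpos _ hn⟩
        show labCross D (ρ 4) (stLab D (j, ρ)) = stLab D (crossLast D (j, ρ))
        simp only [labCross, stLab, crossLast, Finset.image_singleton]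
        rfl
  obtain ⟨n, hn, hsn⟩ := key _ hR
  apply cross_rev_free D n (i, π)
  set s := (crossPerm D ^ n) (i, π)
  obtain ⟨j, ρ⟩ := s
  simp only [stLab, Prod.mk.injEq, Finset.singleton_inj] at hn hsn
  obtain ⟨rfl, e0, e1, e2⟩ := hn
  have hρ : (π * (Equiv.swap 0 1 * Equiv.swap 3 4))⁻¹ * ρ = 1 := by
    apply perm5_eq_one
    · rw [Equiv.Perm.mul_apply, Equiv.Perm.inv_eq_iff_eq, ← e0, ← h1]; rfl
    · rw [Equiv.Perm.mul_apply, Equiv.Perm.inv_eq_iff_eq, ← e1, ← h0]; rfl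
    · rw [Equiv.Perm.mul_apply, Equiv.Perm.inv_eq_iff_eq, ← e2, ← h2]; rfl
    · rw [map_mul, map_inv, map_mul, map_mul, Equiv.Perm.sign_swap (by decide),
        Equiv.Perm.sign_swap (by decide), Int.units_inv_eq_self]
      have h5 : Equiv.Perm.sign ρ = Equiv.Perm.sign π := mul_left_cancel (hsn.trans hs.symm)
      rw [h5]
      simp
  refine Prod.ext rfl ?_
  show ρ = π * (Equiv.swap 0 1 * Equiv.swap 3 4)
  exact (inv_mul_eq_one.mp hρ).symm

theorem edge_free (D : GlueingDatum 4)
    (i : D.I) (a b : Fin 5) (S : Finset (Fin 5)) (hab : a ≠ b) (ha : a ∉ S) (hb : b ∉ S)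
    (hS : S.card = 2) :
    ¬ Relation.ReflTransGen (labStep D) (i, a, b, S) (i, b, a, S) := by
  intro hR
  have hcard : ((insert a (insert b S))ᶜ : Finset (Fin 5)).card = 1 := by
    rw [Finset.card_compl, Finset.card_insert_of_notMem (by simp [hab, ha]),
      Finset.card_insert_of_notMem hb, hS]; rfl
  obtain ⟨k, hk⟩ := Finset.card_eq_one.mp hcard
  have hk' : ∀ m, (m ≠ a ∧ m ≠ b ∧ m ∉ S) ↔ m = k := by
    intro m
    rw [← Finset.mem_singleton, ← hk]
    simp
  have key : ∀ y, Relation.ReflTransGen (labStep D) (i, a, b, S) y →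
      y = (i, a, b, S) ∨ y = labCross D k (i, a, b, S) := by
    intro y hy
    induction hy with
    | refl => exact Or.inl rfl
    | tail _ h ih =>
      obtain ⟨m, m0, m1, m2, rfl⟩ := h
      rcases ih with rfl | rfl
      · right
        rw [(hk' m).mp ⟨m0, m1, m2⟩]
      · left
        obtain ⟨m, rfl⟩ := (D.glue (i, k)).surjective m
        simp only [labCross, ne_eq, EmbeddingLike.apply_eq_iff_eq, Finset.mem_image,
          exists_eq_right] at m0 m1 m2
        rw [(hk' m).mp ⟨m0, m1, m2⟩]
        exact labCross_back D k (i, a, b, S)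
  rcases key _ hR with h | h
  · simp only [Prod.mk.injEq] at h
    exact hab h.2.1.symm
  · simp only [labCross, Prod.mk.injEq] at h
    obtain ⟨h1, h2, h3, h4⟩ := h
    refine no_self_glue D i k h1.symm ((hk' _).mp ?_)
    obtain ⟨q1, q2, q3⟩ := (hk' k).mpr rfl
    refine ⟨fun h => q2 ?_, fun h => q1 ?_, fun h => q3 ?_⟩
    · rw [h3] at h; exact (D.glue (i, k)).injective h
    · rw [h2] at h; exact (D.glue (i, k)).injective h
    · rw [h4] at h; simpa using h

theorem lab_free (D : GlueingDatum 4) (ε : D.I → ℤˣ)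
    (hε : ∀ i k, ε (D.P (i, k)).1 = - (ε i * Equiv.Perm.sign (D.glue (i, k))))
    (i : D.I) (a b : Fin 5) (S : Finset (Fin 5)) (hab : a ≠ b) (ha : a ∉ S) (hb : b ∉ S)
    (hS : S.Nonempty) :
    ¬ Relation.ReflTransGen (labStep D) (i, a, b, S) (i, b, a, S) := by
  have hcard : ((insert a (insert b S))ᶜ : Finset (Fin 5)).card = 5 - (S.card + 1 + 1) := by
    rw [Finset.card_compl, Finset.card_insert_of_notMem (by simp [hab, ha]),
      Finset.card_insert_of_notMem hb]; rfl
  have hle : S.card + 1 + 1 ≤ 5 := by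
    rw [← Finset.card_insert_of_notMem hb, ← Finset.card_insert_of_notMem
      (show a ∉ insert b S by simp [hab, ha])]
    exact Finset.card_le_univ _
  have hpos := hS.card_pos
  have hc : S.card = 1 ∨ S.card = 2 ∨ S.card = 3 := by omega
  rcases hc with h | h | h
  · obtain ⟨c, rfl⟩ := Finset.card_eq_one.mp h
    simp only [Finset.mem_singleton] at ha hb
    exact vertex_free D ε hε i a b c hab ha hb
  · exact edge_free D i a b S hab ha hb h
  · intro hR
    rw [h] at hcard
    have he := Finset.card_eq_zero.mp (hcard.trans (by norm_num))
    rcases Relation.ReflTransGen.cases_head hR with h1 | ⟨y, ⟨k, k0, k1, k2, -⟩, -⟩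
    · simp only [Prod.mk.injEq] at h1
      exact hab h1.2.1
    · have : k ∈ ((insert a (insert b S))ᶜ : Finset (Fin 5)) := by
        simp only [Finset.mem_compl, Finset.mem_insert, not_or]
        exact ⟨k0, k1, k2⟩
      rw [he] at this
      simp at this

abbrev DPair : Type := {t : Fin 5 × Fin 5 // t.1 ≠ t.2}

/-- Disjoint union of directed triangles. -/
abbrev DirTotal (D : GlueingDatum 4) : Type :=
  Σ p : D.I × DPair, LabTri {p.2.1.1, p.2.1.2}

def dirRel (D : GlueingDatum 4) (p q : DirTotal D) : Prop :=
  ∃ k : Fin 5, k ≠ p.1.2.1.1 ∧ k ≠ p.1.2.1.2 ∧ p.2.1 k = 0 ∧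
    (D.P (p.1.1, k)).1 = q.1.1 ∧
    q.1.2.1.1 = D.glue (p.1.1, k) p.1.2.1.1 ∧
    q.1.2.1.2 = D.glue (p.1.1, k) p.1.2.1.2 ∧
    (q.2.1 : Fin 5 → ℝ) = p.2.1 ∘ ⇑(D.glue (p.1.1, k)).symm

/-- The double cover. -/
abbrev DirSpace (D : GlueingDatum 4) : Type := Quot (dirRel D)

theorem dirTotal_ext {D : GlueingDatum 4} {p q : DirTotal D} (h0 : p.1.1 = q.1.1)
    (h1 : p.1.2.1.1 = q.1.2.1.1) (h2 : p.1.2.1.2 = q.1.2.1.2) (h3 : p.2.1 = q.2.1) : p = q := by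
  obtain ⟨⟨i, ⟨⟨a, b⟩, h⟩⟩, x⟩ := p
  obtain ⟨⟨j, ⟨⟨c, d⟩, h'⟩⟩, y⟩ := q
  simp only at h0 h1 h2 h3
  subst h0 h1 h2
  have : x = y := Subtype.ext h3
  rw [this]

theorem surfTotal_ext {D : GlueingDatum 4} {p q : SurfTotal D} (h0 : p.1.1 = q.1.1)
    (h1 : p.1.2.1 = q.1.2.1) (h3 : p.2.1 = q.2.1) : p = q := by
  obtain ⟨⟨i, ⟨s, h⟩⟩, x⟩ := p
  obtain ⟨⟨j, ⟨t, h'⟩⟩, y⟩ := q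
  simp only at h0 h1 h3
  subst h0 h1
  have : x = y := Subtype.ext h3
  rw [this]

def dirForget (D : GlueingDatum 4) (p : DirTotal D) : SurfTotal D :=
  ⟨(p.1.1, ⟨{p.1.2.1.1, p.1.2.1.2}, Finset.card_pair p.1.2.2⟩), p.2⟩

def dirFlip (D : GlueingDatum 4) (p : DirTotal D) : DirTotal D :=
  ⟨(p.1.1, ⟨(p.1.2.1.2, p.1.2.1.1), p.1.2.2.symm⟩),
    ⟨p.2.1, p.2.2.1, p.2.2.2.1, fun v hv => p.2.2.2.2 v (by rwa [Finset.pair_comm])⟩⟩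

theorem dirFlip_flip (D : GlueingDatum 4) (p : DirTotal D) : dirFlip D (dirFlip D p) = p :=
  dirTotal_ext rfl rfl rfl rfl

theorem dirForget_flip (D : GlueingDatum 4) (p : DirTotal D) :
    dirForget D (dirFlip D p) = dirForget D p :=
  surfTotal_ext rfl (Finset.pair_comm _ _) rfl

theorem dirForget_eq (D : GlueingDatum 4) (p q : DirTotal D)
    (h : dirForget D p = dirForget D q) : p = q ∨ p = dirFlip D q := by
  have h0 : p.1.1 = q.1.1 := congrArg (fun z : SurfTotal D => z.1.1) h
  have h1 : ({p.1.2.1.1, p.1.2.1.2} : Finset (Fin 5)) = {q.1.2.1.1, q.1.2.1.2} :=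
    congrArg (fun z : SurfTotal D => z.1.2.1) h
  have h2 : p.2.1 = q.2.1 := congrArg (fun z : SurfTotal D => z.2.1) h
  have hp := p.1.2.2
  have e1 : p.1.2.1.1 ∈ ({q.1.2.1.1, q.1.2.1.2} : Finset (Fin 5)) := by rw [← h1]; simp
  have e2 : p.1.2.1.2 ∈ ({q.1.2.1.1, q.1.2.1.2} : Finset (Fin 5)) := by rw [← h1]; simp
  simp only [Finset.mem_insert, Finset.mem_singleton] at e1 e2
  rcases e1 with e1 | e1 <;> rcases e2 with e2 | e2
  · exact absurd (e1.trans e2.symm) hp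
  · exact Or.inl (dirTotal_ext h0 e1 e2 h2)
  · exact Or.inr (dirTotal_ext h0 e1 e2 h2)
  · exact absurd (e1.trans e2.symm) hp

theorem dirForget_surjective (D : GlueingDatum 4) : Function.Surjective (dirForget D) := by
  rintro ⟨⟨i, ⟨s, h⟩⟩, x⟩
  obtain ⟨a, b, hab, rfl⟩ := Finset.card_eq_two.mp h
  exact ⟨⟨(i, ⟨(a, b), hab⟩), x⟩, rfl⟩

theorem dirForget_isQuotientMap (D : GlueingDatum 4) :
    Topology.IsQuotientMap (dirForget D) := by
  rw [Topology.isQuotientMap_iff, Topology.isCoinducing_iff]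
  refine ⟨fun U => Iff.symm ?_, dirForget_surjective D⟩
  rw [isOpen_sigma_iff, isOpen_sigma_iff]
  constructor
  · rintro h ⟨i, ⟨⟨a, b⟩, hab⟩⟩
    exact h (i, ⟨{a, b}, Finset.card_pair hab⟩)
  · rintro h ⟨i, ⟨s, hs⟩⟩
    obtain ⟨a, b, hab, rfl⟩ := Finset.card_eq_two.mp hs
    exact h (i, ⟨(a, b), hab⟩)

theorem dirFlip_continuous (D : GlueingDatum 4) : Continuous (dirFlip D) := by
  rw [continuous_sigma_iff]
  rintro ⟨i, ⟨⟨a, b⟩, hab⟩⟩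
  have hm : ∀ x : LabTri {a, b}, (∀ v, 0 ≤ x.1 v) ∧ (∑ v, x.1 v = 1) ∧
      ∀ v ∈ ({b, a} : Finset (Fin 5)), x.1 v = 0 := fun x =>
    ⟨x.2.1, x.2.2.1, fun v hv => x.2.2.2 v (by rwa [Finset.pair_comm])⟩
  have h : Continuous fun x : LabTri {a, b} => (⟨x.1, hm x⟩ : LabTri {b, a}) :=
    continuous_subtype_val.subtype_mk hm
  exact (continuous_sigmaMk (σ := fun p : D.I × DPair => LabTri {p.2.1.1, p.2.1.2})
    (i := (i, ⟨(b, a), hab.symm⟩))).comp h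

theorem dirRel_flip (D : GlueingDatum 4) (p q : DirTotal D) (h : dirRel D p q) :
    dirRel D (dirFlip D p) (dirFlip D q) := by
  obtain ⟨k, h1, h2, h3, h4, h5, h6, h7⟩ := h
  exact ⟨k, h2, h1, h3, h4, h6, h5, h7⟩

theorem dirRel_forget (D : GlueingDatum 4) (p q : DirTotal D) (h : dirRel D p q) :
    surfRel D (dirForget D p) (dirForget D q) := by
  obtain ⟨k, h1, h2, h3, h4, h5, h6, h7⟩ := h
  refine ⟨k, ?_, h3, h4, ?_, h7⟩
  · simp [dirForget, h1, h2]
  · simp [dirForget, h5, h6, Finset.image_insert]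

theorem surfRel_symm (D : GlueingDatum 4) (p q : SurfTotal D) (h : surfRel D p q) :
    surfRel D q p := by
  obtain ⟨k, h1, h2, h3, h4, h5⟩ := h
  refine ⟨D.glue (p.1.1, k) k, ?_, ?_, ?_, ?_, ?_⟩
  · rw [h4]; simpa using h1
  · rw [h5]; simpa using h2
  · rw [← h3, P_back]
  · rw [← h3, glue_back, h4, Finset.image_image]; simp
  · rw [← h3, glue_back, h5]; funext v; simp

theorem surfRel_lift (D : GlueingDatum 4) (p : DirTotal D) (v : SurfTotal D)
    (h : surfRel D (dirForget D p) v) : ∃ q, dirForget D q = v ∧ dirRel D p q := by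
  obtain ⟨⟨i, ⟨⟨a, b⟩, hab⟩⟩, x⟩ := p
  obtain ⟨⟨j, ⟨t, ht⟩⟩, y⟩ := v
  obtain ⟨k, h1, h2, h3, h4, h5⟩ := h
  simp only [dirForget, Finset.image_insert, Finset.image_singleton, Finset.mem_insert,
    Finset.mem_singleton, not_or] at h1 h2 h3 h4 h5
  subst h4
  exact ⟨⟨(j, ⟨(D.glue (i, k) a, D.glue (i, k) b), fun h => hab ((D.glue (i, k)).injective h)⟩),
    y⟩, rfl, k, h1.1, h1.2, h2, h3, rfl, rfl, h5⟩

def dirProj (D : GlueingDatum 4) : DirSpace D → SurfSpace D :=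
  Quot.map (dirForget D) (dirRel_forget D)

def dirFlipE (D : GlueingDatum 4) : DirSpace D → DirSpace D :=
  Quot.map (dirFlip D) (dirRel_flip D)

theorem dirFlipE_continuous (D : GlueingDatum 4) : Continuous (dirFlipE D) :=
  continuous_quot_lift _ (continuous_quot_mk.comp (dirFlip_continuous D))

theorem dirFlipE_flipE (D : GlueingDatum 4) (e : DirSpace D) : dirFlipE D (dirFlipE D e) = e := by
  obtain ⟨p, rfl⟩ := Quot.exists_rep e
  exact congrArg (Quot.mk _) (dirFlip_flip D p)

theorem dirProj_isQuotientMap (D : GlueingDatum 4) : Topology.IsQuotientMap (dirProj D) := by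
  have h : Topology.IsQuotientMap (dirProj D ∘ Quot.mk (dirRel D)) :=
    (isQuotientMap_quot_mk (r := surfRel D)).comp (dirForget_isQuotientMap D)
  exact Topology.IsQuotientMap.of_comp continuous_quot_mk
    (continuous_quot_lift _ (continuous_quot_mk.comp (dirForget_isQuotientMap D).continuous)) h

theorem dirProj_fiber_aux (D : GlueingDatum 4) (u v : SurfTotal D)
    (h : Relation.EqvGen (surfRel D) u v) :
    (∀ p, dirForget D p = u → ∃ q, dirForget D q = v ∧
      Quot.mk (dirRel D) p = Quot.mk (dirRel D) q) ∧
    (∀ q, dirForget D q = v → ∃ p, dirForget D p = u ∧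
      Quot.mk (dirRel D) p = Quot.mk (dirRel D) q) := by
  induction h with
  | rel u v h =>
    constructor
    · rintro p rfl
      obtain ⟨q, h1, h2⟩ := surfRel_lift D p v h
      exact ⟨q, h1, Quot.sound h2⟩
    · rintro q rfl
      obtain ⟨p, h1, h2⟩ := surfRel_lift D q u (surfRel_symm D _ _ h)
      exact ⟨p, h1, (Quot.sound h2).symm⟩
  | refl u => exact ⟨fun p hp => ⟨p, hp, rfl⟩, fun p hp => ⟨p, hp, rfl⟩⟩
  | symm u v _ ih =>
    refine ⟨fun p hp => ?_, fun p hp => ?_⟩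
    · obtain ⟨q, h1, h2⟩ := ih.2 p hp
      exact ⟨q, h1, h2.symm⟩
    · obtain ⟨q, h1, h2⟩ := ih.1 p hp
      exact ⟨q, h1, h2.symm⟩
  | trans u v w _ _ ih1 ih2 =>
    refine ⟨fun p hp => ?_, fun p hp => ?_⟩
    · obtain ⟨q, h1, h2⟩ := ih1.1 p hp
      obtain ⟨r, h3, h4⟩ := ih2.1 q h1
      exact ⟨r, h3, h2.trans h4⟩
    · obtain ⟨q, h1, h2⟩ := ih2.2 p hp
      obtain ⟨r, h3, h4⟩ := ih1.2 q h1
      exact ⟨r, h3, h4.trans h2⟩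

theorem dirProj_fiber (D : GlueingDatum 4) (e e' : DirSpace D) :
    dirProj D e = dirProj D e' ↔ e = e' ∨ e = dirFlipE D e' := by
  constructor
  · intro h
    obtain ⟨p, rfl⟩ := Quot.exists_rep e
    obtain ⟨q, rfl⟩ := Quot.exists_rep e'
    obtain ⟨r, h1, h2⟩ := (dirProj_fiber_aux D _ _ (Quot.eqvGen_exact h)).1 p rfl
    rw [h2]
    rcases dirForget_eq D r q h1 with rfl | rfl
    · exact Or.inl rfl
    · exact Or.inr rfl
  · rintro (rfl | rfl)
    · rfl
    · obtain ⟨q, rfl⟩ := Quot.exists_rep e'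
      exact congrArg (Quot.mk _) (dirForget_flip D q)

/-- Odd continuous function attached to an invariant set of labels. -/
def oddFun (D : GlueingDatum 4) (O : DirLab D → Prop) (p : DirTotal D) : ℝ :=
  ∑ S : Finset (Fin 5), ((if O (p.1.1, p.1.2.1.1, p.1.2.1.2, S) then (1 : ℝ) else 0) -
    (if O (p.1.1, p.1.2.1.2, p.1.2.1.1, S) then (1 : ℝ) else 0)) * ∏ v ∈ S, p.2.1 v

theorem oddFun_flip (D : GlueingDatum 4) (O : DirLab D → Prop) (p : DirTotal D) :
    oddFun D O (dirFlip D p) = - oddFun D O p := by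
  unfold oddFun
  rw [← Finset.sum_neg_distrib]
  refine Finset.sum_congr rfl fun S _ => ?_
  rw [← neg_mul, neg_sub]
  rfl

theorem oddFun_continuous (D : GlueingDatum 4) (O : DirLab D → Prop) :
    Continuous (oddFun D O) := by
  rw [continuous_sigma_iff]
  rintro ⟨i, ⟨⟨a, b⟩, hab⟩⟩
  unfold oddFun
  refine continuous_finsetSum _ fun S _ => ?_
  have h : Continuous fun x : LabTri {a, b} => ∏ v ∈ S, x.1 v :=
    continuous_finsetProd _ fun v _ => (continuous_apply v).comp continuous_subtype_val
  exact Continuous.mul (f := fun _ : LabTri {a, b} =>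
    (if O (i, a, b, S) then (1 : ℝ) else 0) - (if O (i, b, a, S) then (1 : ℝ) else 0))
    continuous_const h

theorem oddFun_inv (D : GlueingDatum 4) (O : DirLab D → Prop)
    (hO : ∀ x y, labStep D x y → (O x ↔ O y)) (p q : DirTotal D) (h : dirRel D p q) :
    oddFun D O p = oddFun D O q := by
  obtain ⟨k, h1, h2, h3, h4, h5, h6, h7⟩ := h
  unfold oddFun
  refine Fintype.sum_equiv (Equiv.finsetCongr (D.glue (p.1.1, k))) _ _ fun S => ?_
  have hp : ∏ v ∈ (Equiv.finsetCongr (D.glue (p.1.1, k))) S, q.2.1 v = ∏ v ∈ S, p.2.1 v := by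
    rw [h7, Equiv.finsetCongr_apply, Finset.prod_map]
    simp
  rw [hp]
  by_cases hk : k ∈ S
  · rw [Finset.prod_eq_zero hk h3, mul_zero, mul_zero]
  · have e1 := hO (p.1.1, p.1.2.1.1, p.1.2.1.2, S) _ ⟨k, h1, h2, hk, rfl⟩
    have e2 := hO (p.1.1, p.1.2.1.2, p.1.2.1.1, S) _ ⟨k, h2, h1, hk, rfl⟩
    have hm : Equiv.finsetCongr (D.glue (p.1.1, k)) S = S.image (D.glue (p.1.1, k)) := by
      rw [Equiv.finsetCongr_apply, Finset.map_eq_image]; rfl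
    simp only [labCross] at e1 e2
    rw [h5, h6, ← h4, hm]
    simp only [e1, e2]

theorem oddFun_pos (D : GlueingDatum 4) (ε : D.I → ℤˣ)
    (hε : ∀ i k, ε (D.P (i, k)).1 = - (ε i * Equiv.Perm.sign (D.glue (i, k))))
    (p : DirTotal D) : ∃ O : DirLab D → Prop, (∀ x y, labStep D x y → (O x ↔ O y)) ∧
      0 < oddFun D O p := by
  let T : Finset (Fin 5) := Finset.univ.filter fun v => p.2.1 v ≠ 0
  have hT : ∀ v, v ∈ T ↔ p.2.1 v ≠ 0 := fun v => by simp [T]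
  refine ⟨fun y => Relation.ReflTransGen (labStep D) (p.1.1, p.1.2.1.1, p.1.2.1.2, T) y,
    fun x y h => ⟨fun h' => h'.tail h, fun h' => h'.tail (labStep_symm D _ _ h)⟩, ?_⟩
  have ha : p.1.2.1.1 ∉ T := by
    rw [hT, not_not]; exact p.2.2.2.2 _ (by simp)
  have hb : p.1.2.1.2 ∉ T := by
    rw [hT, not_not]; exact p.2.2.2.2 _ (by simp)
  have hne : T.Nonempty := by
    by_contra h
    rw [Finset.not_nonempty_iff_eq_empty] at h
    have h0 : ∀ v, p.2.1 v = 0 := fun v => by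
      by_contra hv
      have := (hT v).mpr hv
      rw [h] at this
      simp at this
    have h1 := p.2.2.2.1
    rw [Finset.sum_eq_zero fun v _ => h0 v] at h1
    exact zero_ne_one h1
  unfold oddFun
  rw [Finset.sum_eq_single T]
  · rw [if_pos Relation.ReflTransGen.refl, if_neg (lab_free D ε hε _ _ _ T p.1.2.2 ha hb hne),
      sub_zero, one_mul]
    exact Finset.prod_pos fun v hv => lt_of_le_of_ne (p.2.2.1 v) ((hT v).mp hv).symm
  · intro S _ hS
    by_cases hsub : S ⊆ T
    · have hc : S.card ≠ T.card := fun h => hS (Finset.eq_of_subset_of_card_le hsub h.ge)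
      rw [if_neg fun h => hc (labStep_card D _ _ h), if_neg fun h => hc (labStep_card D _ _ h)]
      simp
    · obtain ⟨v, hv, hvT⟩ := Finset.not_subset.mp hsub
      rw [hT, not_not] at hvT
      rw [Finset.prod_eq_zero hv hvT, mul_zero]
  · simp

theorem exists_odd (D : GlueingDatum 4) (ε : D.I → ℤˣ)
    (hε : ∀ i k, ε (D.P (i, k)).1 = - (ε i * Equiv.Perm.sign (D.glue (i, k))))
    (e : DirSpace D) : ∃ g : DirSpace D → ℝ, Continuous g ∧ (∀ z, g (dirFlipE D z) = - g z) ∧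
      0 < g e := by
  obtain ⟨p, rfl⟩ := Quot.exists_rep e
  obtain ⟨O, hO, hp⟩ := oddFun_pos D ε hε p
  refine ⟨Quot.lift (oddFun D O) (oddFun_inv D O hO),
    continuous_quot_lift _ (oddFun_continuous D O), fun z => ?_, hp⟩
  obtain ⟨q, rfl⟩ := Quot.exists_rep z
  exact oddFun_flip D O q

theorem dirFlipE_ne (D : GlueingDatum 4) (ε : D.I → ℤˣ)
    (hε : ∀ i k, ε (D.P (i, k)).1 = - (ε i * Equiv.Perm.sign (D.glue (i, k))))
    (e : DirSpace D) : dirFlipE D e ≠ e := by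
  intro h
  obtain ⟨g, -, h1, h2⟩ := exists_odd D ε hε e
  have := h1 e
  rw [h] at this
  linarith

instance dirAction (D : GlueingDatum 4) : MulAction ℤˣ (DirSpace D) where
  smul u e := if u = 1 then e else dirFlipE D e
  one_smul e := if_pos rfl
  mul_smul u v e := by
    show (if u * v = 1 then e else dirFlipE D e) =
      if u = 1 then (if v = 1 then e else dirFlipE D e)
        else dirFlipE D (if v = 1 then e else dirFlipE D e)
    rcases Int.units_eq_one_or u with rfl | rfl <;> rcases Int.units_eq_one_or v with rfl | rfl
    · simp
    · simp
    · simp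
    · rw [if_pos (by decide), if_neg (by decide), if_neg (by decide), dirFlipE_flipE]

theorem dirProj_isCoveringMap (D : GlueingDatum 4) (ε : D.I → ℤˣ)
    (hε : ∀ i k, ε (D.P (i, k)).1 = - (ε i * Equiv.Perm.sign (D.glue (i, k)))) :
    IsCoveringMap (dirProj D) := by
  have hsm1 : ∀ e : DirSpace D, (1 : ℤˣ) • e = e := fun e => one_smul _ e
  have hsm2 : ∀ e : DirSpace D, (-1 : ℤˣ) • e = dirFlipE D e := fun e => if_neg (by decide)
  suffices hq : IsQuotientCoveringMap (dirProj D) ℤˣ from hq.isCoveringMap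
  refine
    { toIsQuotientMap := dirProj_isQuotientMap D, continuous_const_smul := ?_,
      apply_eq_iff_mem_orbit := ?_, disjoint := ?_ }
  · intro u
    rcases Int.units_eq_one_or u with rfl | rfl
    · simp only [hsm1]; exact continuous_id
    · simp only [hsm2]; exact dirFlipE_continuous D
  · intro e e'
    rw [dirProj_fiber]
    constructor
    · rintro (h | h)
      · exact ⟨1, by simp only [hsm1, h]⟩
      · exact ⟨-1, by simp only [hsm2, h]⟩
    · rintro ⟨u, h⟩
      rcases Int.units_eq_one_or u with rfl | rfl
      · simp only [hsm1] at h; exact Or.inl h.symm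
      · simp only [hsm2] at h; exact Or.inr h.symm
  · intro e
    obtain ⟨g, hg, h1, h2⟩ := exists_odd D ε hε e
    refine ⟨g ⁻¹' Set.Ioi 0, (isOpen_Ioi.preimage hg).mem_nhds h2, fun u hu => ?_⟩
    rcases Int.units_eq_one_or u with rfl | rfl
    · rfl
    · obtain ⟨z, ⟨w, hw, rfl⟩, hz⟩ := hu
      simp only [hsm2, Set.mem_preimage, Set.mem_Ioi, h1] at hw hz
      linarith

theorem exists_component_section {D : GlueingDatum 4} (cov : IsCoveringMap (dirProj D))
    (hSurf : Surf D) (z : SurfSpace D) : ∃ s : SurfSpace D → DirSpace D,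
      ContinuousOn s (connectedComponent z) ∧ ∀ w ∈ connectedComponent z, dirProj D (s w) = w := by
  obtain ⟨h⟩ := hSurf z
  obtain ⟨F, hF, hFp⟩ := sphere_lift cov (dirProj_isQuotientMap D).surjective
    ⟨fun y => (h.symm y).1, continuous_subtype_val.comp h.symm.continuous⟩
  have e0 : DirSpace D := F (h ⟨z, mem_connectedComponent⟩)
  refine ⟨fun w => if hw : w ∈ connectedComponent z then F (h ⟨w, hw⟩) else e0, ?_, ?_⟩
  · rw [continuousOn_iff_continuous_domRestrict]
    have : (connectedComponent z).domRestrict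
        (fun w => if hw : w ∈ connectedComponent z then F (h ⟨w, hw⟩) else e0) = F ∘ h := by
      funext w
      simp [Set.domRestrict]
    rw [this]
    exact hF.comp h.continuous
  · intro w hw
    simp only [dif_pos hw, hFp]
    simp

theorem exists_section {D : GlueingDatum 4} (cov : IsCoveringMap (dirProj D))
    (hSurf : Surf D) : ∃ s : SurfSpace D → DirSpace D,
      (∀ z, ContinuousOn s (connectedComponent z)) ∧ ∀ w, dirProj D (s w) = w := by
  have key : ∀ C : Set (SurfSpace D), ∃ s : SurfSpace D → DirSpace D,
      (∃ z, C = connectedComponent z) → ContinuousOn s C ∧ ∀ w ∈ C, dirProj D (s w) = w := by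
    intro C
    by_cases hC : ∃ z, C = connectedComponent z
    · obtain ⟨z, rfl⟩ := hC
      obtain ⟨s, hs⟩ := exists_component_section cov hSurf z
      exact ⟨s, fun _ => hs⟩
    · exact ⟨fun w => ((dirProj_isQuotientMap D).surjective w).choose, fun h => absurd h hC⟩
  choose S hS using key
  refine ⟨fun w => S (connectedComponent w) w, fun z => ?_, fun w =>
    (hS _ ⟨w, rfl⟩).2 w mem_connectedComponent⟩
  refine (hS _ ⟨z, rfl⟩).1.congr fun w hw => ?_
  simp only [connectedComponent_eq hw]

theorem labTri_preconnected (s : Finset (Fin 5)) : PreconnectedSpace (LabTri s) := by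
  refine Subtype.preconnectedSpace (Convex.isPreconnected ?_)
  intro x hx y hy t u ht hu htu
  refine ⟨fun v => ?_, ?_, fun v hv => ?_⟩
  · have := hx.1 v; have := hy.1 v
    simp only [Pi.add_apply, Pi.smul_apply, smul_eq_mul]; positivity
  · simp only [Pi.add_apply, Pi.smul_apply, smul_eq_mul, Finset.sum_add_distrib,
      ← Finset.mul_sum, hx.2.1, hy.2.1]
    linarith
  · simp [hx.2.2 v hv, hy.2.2 v hv]

def dirMk (D : GlueingDatum 4) (i : D.I) (a b : Fin 5) (h : a ≠ b) (x : LabTri {a, b}) :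
    DirSpace D := Quot.mk _ ⟨(i, ⟨(a, b), h⟩), x⟩

theorem dirMk_continuous (D : GlueingDatum 4) (i : D.I) (a b : Fin 5) (h : a ≠ b) :
    Continuous (dirMk D i a b h) :=
  continuous_quot_mk.comp (continuous_sigmaMk
    (σ := fun p : D.I × DPair => LabTri {p.2.1.1, p.2.1.2}) (i := (i, ⟨(a, b), h⟩)))

theorem dirMk_all {D : GlueingDatum 4} (cov : IsCoveringMap (dirProj D))
    (s : SurfSpace D → DirSpace D) (hs : ∀ z, ContinuousOn s (connectedComponent z))
    (hp : ∀ w, dirProj D (s w) = w) (i : D.I) (a b : Fin 5) (h : a ≠ b) (x : LabTri {a, b})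
    (hx : s (dirProj D (dirMk D i a b h x)) = dirMk D i a b h x) (y : LabTri {a, b}) :
    s (dirProj D (dirMk D i a b h y)) = dirMk D i a b h y := by
  have := labTri_preconnected {a, b}
  have hc : Continuous fun y => dirProj D (dirMk D i a b h y) :=
    (dirProj_isQuotientMap D).continuous.comp (dirMk_continuous D i a b h)
  have hmem : ∀ y, dirProj D (dirMk D i a b h y) ∈
      connectedComponent (dirProj D (dirMk D i a b h x)) := fun y =>
    (isPreconnected_range hc).subset_connectedComponent ⟨x, rfl⟩ ⟨y, rfl⟩
  have hsc : Continuous fun y => s (dirProj D (dirMk D i a b h y)) :=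
    (hs _).comp_continuous hc hmem
  exact congrFun (cov.eq_of_comp_eq hsc (dirMk_continuous D i a b h)
    (funext fun y => hp _) x hx) y

theorem exists_labTri (s : Finset (Fin 5)) (c : Fin 5) (hc : c ∉ s) :
    (∀ v, 0 ≤ (Pi.single c 1 : Fin 5 → ℝ) v) ∧ (∑ v, (Pi.single c 1 : Fin 5 → ℝ) v = 1) ∧
      ∀ v ∈ s, (Pi.single c 1 : Fin 5 → ℝ) v = 0 := by
  refine ⟨fun v => ?_, by simp, fun v hv => ?_⟩
  · by_cases h : v = c
    · subst h; simp
    · simp [Pi.single_eq_of_ne h]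
  · have hne : v ≠ c := fun h => hc (h ▸ hv)
    exact Pi.single_eq_of_ne hne _

theorem exists_fresh (a b k : Fin 5) : ∃ c, c ≠ a ∧ c ≠ b ∧ c ≠ k := by
  revert a b k; decide

/-- Second assertion of Proposition '4-dim orientation': in dimension 4, conditions Ori
and Surf jointly imply condition Dir. -/
theorem ori_and_surf_imply_dir_dim4 (D : GlueingDatum 4)
    (hOri : Ori D) (hSurf : Surf D) : Dir D := by
  obtain ⟨ε, hε0⟩ := hOri
  have hε := ori_sign D ε hε0
  have cov := dirProj_isCoveringMap D ε hε
  obtain ⟨s, hs, hp⟩ := exists_section cov hSurf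
  let o : D.I → Fin 5 → Fin 5 → Prop := fun i a b => ∃ h : a ≠ b, ∀ x : LabTri {a, b},
    s (dirProj D (dirMk D i a b h x)) = dirMk D i a b h x
  have hflip : ∀ (i : D.I) (a b : Fin 5) (h : a ≠ b) (c : Fin 5) (h1 : c ∉ ({a, b} : Finset (Fin 5)))
      (h2 : c ∉ ({b, a} : Finset (Fin 5))),
      dirFlipE D (dirMk D i a b h ⟨Pi.single c 1, exists_labTri _ c h1⟩) =
        dirMk D i b a h.symm ⟨Pi.single c 1, exists_labTri _ c h2⟩ := fun _ _ _ _ _ _ _ => rfl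
  have hxor : ∀ i a b, a ≠ b → Xor' (o i a b) (o i b a) := by
    intro i a b hab
    obtain ⟨c, hca, hcb, -⟩ := exists_fresh a b a
    have h1 : c ∉ ({a, b} : Finset (Fin 5)) := by simp [hca, hcb]
    have h2 : c ∉ ({b, a} : Finset (Fin 5)) := by simp [hca, hcb]
    have hf := hflip i a b hab c h1 h2
    have hproj : dirProj D (dirMk D i b a hab.symm ⟨Pi.single c 1, exists_labTri _ c h2⟩) =
        dirProj D (dirMk D i a b hab ⟨Pi.single c 1, exists_labTri _ c h1⟩) := by
      rw [← hf]
      exact (dirProj_fiber D _ _).2 (Or.inr rfl)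
    have hne := dirFlipE_ne D ε hε (dirMk D i a b hab ⟨Pi.single c 1, exists_labTri _ c h1⟩)
    rw [hf] at hne
    have hd := (dirProj_fiber D _ _).1
      (hp (dirProj D (dirMk D i a b hab ⟨Pi.single c 1, exists_labTri _ c h1⟩)))
    rw [hf] at hd
    rcases hd with hd | hd
    · refine Or.inl ⟨⟨hab, fun y => dirMk_all cov s hs hp i a b hab _ hd y⟩, ?_⟩
      rintro ⟨_, h⟩
      have h3 := h ⟨Pi.single c 1, exists_labTri _ c h2⟩
      rw [hproj, hd] at h3
      exact hne h3.symm
    · refine Or.inr ⟨⟨hab.symm, fun y => dirMk_all cov s hs hp i b a hab.symm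
        ⟨Pi.single c 1, exists_labTri _ c h2⟩ (by rw [hproj, hd]) y⟩, ?_⟩
      rintro ⟨_, h⟩
      have h3 := h ⟨Pi.single c 1, exists_labTri _ c h1⟩
      rw [hd] at h3
      exact hne h3
  have himp : ∀ (i : D.I) (k a b : Fin 5), a ≠ k → b ≠ k → a ≠ b →
      o i a b → o (D.P (i, k)).1 (D.glue (i, k) a) (D.glue (i, k) b) := by
    rintro i k a b hak hbk hab ⟨_, h⟩
    obtain ⟨c, hca, hcb, hck⟩ := exists_fresh a b k
    have h1 : c ∉ ({a, b} : Finset (Fin 5)) := by simp [hca, hcb]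
    have h2 : D.glue (i, k) c ∉ ({D.glue (i, k) a, D.glue (i, k) b} : Finset (Fin 5)) := by
      simp [hca, hcb]
    have hab' : D.glue (i, k) a ≠ D.glue (i, k) b := fun h => hab ((D.glue (i, k)).injective h)
    have hq : dirMk D i a b hab ⟨Pi.single c 1, exists_labTri _ c h1⟩ =
        dirMk D (D.P (i, k)).1 _ _ hab' ⟨Pi.single (D.glue (i, k) c) 1, exists_labTri _ _ h2⟩ := by
      refine Quot.sound ⟨k, hak.symm, hbk.symm, Pi.single_eq_of_ne hck.symm _, rfl, rfl, rfl, ?_⟩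
      funext v
      show (Pi.single (D.glue (i, k) c) 1 : Fin 5 → ℝ) v =
        (Pi.single c 1 : Fin 5 → ℝ) ((D.glue (i, k)).symm v)
      simp only [Pi.single_apply, Equiv.symm_apply_eq]
    have h3 := h ⟨Pi.single c 1, exists_labTri _ c h1⟩
    rw [hq] at h3
    exact ⟨hab', fun y => dirMk_all cov s hs hp _ _ _ hab' _ h3 y⟩
  refine ⟨o, hxor, fun i k a b hak hbk hab => ⟨himp i k a b hak hbk hab, fun h => ?_⟩⟩
  have hab' : D.glue (i, k) a ≠ D.glue (i, k) b := fun h => hab ((D.glue (i, k)).injective h)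
  rcases hxor i a b hab with h1 | h1
  · exact h1.1
  · have h2 := himp i k b a hbk hak hab.symm h1.1
    rcases hxor (D.P (i, k)).1 _ _ hab' with h3 | h3
    · exact absurd h2 h3.2
    · exact absurd h h3.2
end
end

section
/- Let n = 2. A glueing datum of dimension n consists of: a finite nonempty index set I (indexing copies Δ_i of the standard n-simplex, realized as {x : {0,…,n} → [0,∞) | Σ_v x_v = 1}, with vertices labeled 0,…,n); a fixed-point-free involution P of the set I × {0,…,n} of codimension-1 faces, where (i,k) denotes the face {x ∈ Δ_i | x_k = 0}; and, for each face (i,k) with P(i,k) = (j,l), a bijection φ_{(i,k)} : {0,…,n}∖{k} → {0,…,n}∖{l}, subject to φ_{(j,l)} = φ_{(i,k)}⁻¹. Let X be the quotient of the disjoint union of the Δ_i by the identifications which, for each (i,k) with P(i,k) = (j,l), identify each point x of the face (i,k) with the point y of the face (j,l) given by y_{φ_{(i,k)}(a)} = x_a for a ≠ k and y_l = 0, endowed with the quotient topology. Then X is a closed topological surface: X is compact, Hausdorff, and every point of X has an open neighborhood homeomorphic to ℝ². -/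
open scoped Classical

noncomputable section

/-- The standard `n`-simplex, in barycentric coordinates. -/
abbrev Delta (n : ℕ) : Type :=
  {x : Fin (n + 1) → ℝ // (∀ v, 0 ≤ x v) ∧ ∑ v, x v = 1}

/-- The disjoint union of the simplices `Δ_i`, `i ∈ I`. -/
abbrev GlueTotal {n : ℕ} (D : GlueingDatum n) : Type := Σ _ : D.I, Delta n

/-- The identifications: for each face `(i,k)` with `P (i,k) = (j,l)`, every point `x`
of the face `(i,k)` (i.e. with `x k = 0`) is identified with the point `y = x ∘ φ⁻¹` of
the face `(j,l)`, which satisfies `y (φ a) = x a` for `a ≠ k` and `y l = 0`. -/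
def glueRel {n : ℕ} (D : GlueingDatum n) : GlueTotal D → GlueTotal D → Prop :=
  fun p q => ∃ k : Fin (n + 1), p.2.1 k = 0 ∧ (D.P (p.1, k)).1 = q.1 ∧
    (q.2.1 : Fin (n + 1) → ℝ) = p.2.1 ∘ ⇑(D.glue (p.1, k)).symm

/-- The glued space `X = S/P`, with the quotient topology. -/
abbrev GlueSpace {n : ℕ} (D : GlueingDatum n) : Type := Quot (glueRel D)

/-- The image in `X` of the vertices of the simplices. -/
def vertexImage {n : ℕ} (D : GlueingDatum n) : Set (GlueSpace D) :=
  {z | ∃ p : GlueTotal D, (∃ v, p.2.1 v = 1) ∧ Quot.mk (glueRel D) p = z}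

/-- The space `X* = X ∖ {vertices}`, with the subspace topology. -/
abbrev GlueSpaceStar {n : ℕ} (D : GlueingDatum n) : Type := ↥((vertexImage D)ᶜ)

/-- Local euclideanness: every point has an open neighborhood homeomorphic to `ℝⁿ`. -/
def LocEuclidean (n : ℕ) (Z : Type) [TopologicalSpace Z] : Prop :=
  ∀ z : Z, ∃ U : Set Z, IsOpen U ∧ z ∈ U ∧
    Nonempty (↥U ≃ₜ EuclideanSpace ℝ (Fin n))

/-! ### The coloured model -/

section Gem

variable {F : Type}

/-- Coloured glueing: `(f,t) ~ (a k f, t)` when `t k = 0`. -/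
def gemRel (a : Fin 3 → F → F) : (Σ _ : F, Delta 2) → (Σ _ : F, Delta 2) → Prop :=
  fun x y => ∃ k, x.2.1 k = 0 ∧ y = ⟨a k x.1, x.2⟩

/-- The coloured glued space. -/
abbrev GemSpace (a : Fin 3 → F → F) : Type := Quot (gemRel a)

/-- The class of a point. -/
def gmk (a : Fin 3 → F → F) (f : F) (t : Delta 2) : GemSpace a := Quot.mk _ ⟨f, t⟩

theorem gmk_step (a : Fin 3 → F → F) (f : F) (t : Delta 2) (k : Fin 3) (h : t.1 k = 0) :
    gmk a (a k f) t = gmk a f t :=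
  (Quot.sound ⟨k, h, rfl⟩).symm

theorem gmk_eq (a : Fin 3 → F → F) (ha : ∀ k f, a k (a k f) = f) {f f' : F} {t t' : Delta 2}
    (h : gmk a f t = gmk a f' t') :
    t = t' ∧ ∀ O : Set F, (∀ k, t.1 k = 0 → ∀ g ∈ O, a k g ∈ O) → f ∈ O → f' ∈ O := by
  have h1 : t = t' := by
    have := congrArg (Quot.lift (fun x : (Σ _ : F, Delta 2) => x.2)
      (by rintro x y ⟨k, _, rfl⟩; rfl)) h
    exact this
  refine ⟨h1, fun O hO hf => ?_⟩
  have := congrArg (Quot.lift (fun x : (Σ _ : F, Delta 2) => x.2 = t ∧ x.1 ∈ O)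
      (by
        rintro x y ⟨k, hk, rfl⟩
        apply propext
        constructor
        · rintro ⟨rfl, h2⟩
          exact ⟨rfl, hO k hk _ h2⟩
        · rintro ⟨rfl, h2⟩
          refine ⟨rfl, ?_⟩
          have := hO k hk _ h2
          rwa [ha] at this)) h
  have h3 : (t = t ∧ f ∈ O) = (t' = t ∧ f' ∈ O) := this
  exact (h3.mp ⟨rfl, hf⟩).2

theorem continuous_gmk (a : Fin 3 → F → F) (f : F) : Continuous (gmk a f) :=
  continuous_quot_mk.comp continuous_sigmaMk

instance compactDelta : CompactSpace (Delta 2) :=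
  isCompact_iff_compactSpace.mp (isCompact_stdSimplex ℝ (Fin 3))

theorem gem_isOpen (a : Fin 3 → F → F) (O : Set F) (V : Set (Delta 2)) (hV : IsOpen V)
    (hO : ∀ k, ∀ t ∈ V, t.1 k = 0 → ∀ g ∈ O, a k g ∈ O) (ha : ∀ k f, a k (a k f) = f) :
    IsOpen {y : GemSpace a | ∃ f ∈ O, ∃ t ∈ V, gmk a f t = y} := by
  rw [← isQuotientMap_quot_mk.isOpen_preimage, isOpen_sigma_iff]
  intro f
  by_cases hf : f ∈ O
  · convert hV using 1
    ext t
    constructor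
    · rintro ⟨f', hf', t', ht', h⟩
      obtain ⟨rfl, _⟩ := gmk_eq a ha h
      exact ht'
    · intro ht
      exact ⟨f, hf, t, ht, rfl⟩
  · convert isOpen_empty using 1
    ext t
    simp only [Set.mem_empty_iff_false, iff_false]
    rintro ⟨f', hf', t', ht', h⟩
    obtain ⟨rfl, h2⟩ := gmk_eq a ha h
    exact hf (h2 O (fun k hk => hO k _ ht' hk) hf')

theorem gem_t2 (a : Fin 3 → F → F) (ha : ∀ k f, a k (a k f) = f) : T2Space (GemSpace a) := by
  refine ⟨?_⟩
  rintro ⟨f, t⟩ ⟨f', t'⟩ hne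
  by_cases htt : t = t'
  · subst htt
    let V : Set (Delta 2) := {s | ∀ k, t.1 k ≠ 0 → s.1 k ≠ 0}
    have hV : IsOpen V := by
      have : V = ⋂ k, {s : Delta 2 | t.1 k ≠ 0 → s.1 k ≠ 0} := by ext; simp [V]
      rw [this]
      refine isOpen_iInter_of_finite fun k => ?_
      by_cases hk : t.1 k = 0
      · simp [hk]
      · simp only [ne_eq, hk, not_false_eq_true, forall_const]
        exact isOpen_ne_fun ((continuous_apply k).comp continuous_subtype_val) continuous_const
    have key : ∀ f0 : F, ∀ k, ∀ s ∈ V, s.1 k = 0 → ∀ g ∈ {g | gmk a g t = gmk a f0 t},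
        a k g ∈ {g | gmk a g t = gmk a f0 t} := by
      intro f0 k s hs hk g hg
      have : t.1 k = 0 := by
        by_contra h
        exact hs k h hk
      exact (gmk_step a g t k this).trans hg
    refine ⟨_, _, gem_isOpen a {g | gmk a g t = gmk a f t} V hV (key f) ha,
      gem_isOpen a {g | gmk a g t = gmk a f' t} V hV (key f') ha,
      ⟨f, rfl, t, fun _ h => h, rfl⟩, ⟨f', rfl, t, fun _ h => h, rfl⟩, ?_⟩
    rw [Set.disjoint_left]
    rintro y ⟨g, hg, s, hs, rfl⟩ ⟨g', hg', s', hs', h⟩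
    obtain ⟨rfl, h2⟩ := gmk_eq a ha h
    have := h2 _ (fun k hk => key f' k _ hs hk) hg'
    exact hne (hg.symm.trans this)
  · obtain ⟨U, V, hU, hV, h1, h2, h3⟩ := t2_separation htt
    refine ⟨_, _, gem_isOpen a Set.univ U hU (by simp) ha, gem_isOpen a Set.univ V hV (by simp) ha,
      ⟨f, trivial, t, h1, rfl⟩, ⟨f', trivial, t', h2, rfl⟩, ?_⟩
    rw [Set.disjoint_left]
    rintro y ⟨g, hg, s, hs, rfl⟩ ⟨g', hg', s', hs', h⟩
    obtain ⟨rfl, _⟩ := gmk_eq a ha h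
    exact (Set.disjoint_left.mp h3 hs) (by assumption)

/-- The cyclic arrangement of the orbit of two fixed-point-free involutions. -/
theorem exists_cycle [Finite F] (p q : F → F) (hp : ∀ f, p (p f) = f) (hq : ∀ f, q (q f) = f)
    (hp' : ∀ f, p f ≠ f) (hq' : ∀ f, q f ≠ f) (f0 : F) :
    ∃ (m : ℕ) (c : ℤ → F), 0 < m ∧ c 0 = f0 ∧ (∀ k, c (2 * k + 1) = p (c (2 * k))) ∧
      (∀ k, c (2 * k + 2) = q (c (2 * k + 1))) ∧
      ∀ n n', c n = c n' ↔ (2 * m : ℤ) ∣ n - n' := by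
  let P : Equiv.Perm F := ⟨p, p, hp, hp⟩
  let Q : Equiv.Perm F := ⟨q, q, hq, hq⟩
  let g : Equiv.Perm F := Q * P
  have hPP : P * P = 1 := by ext f; exact hp f
  have hQQ : Q * Q = 1 := by ext f; exact hq f
  have hPi : P⁻¹ = P := inv_eq_of_mul_eq_one_left hPP
  have hQi : Q⁻¹ = Q := inv_eq_of_mul_eq_one_left hQQ
  have hconj : P * g * P⁻¹ = g⁻¹ := by
    simp only [g, mul_inv_rev, hPi, hQi]
    rw [mul_assoc, mul_assoc, hPP, mul_one]
  have hcz : ∀ k : ℤ, P * g ^ k = g ^ (-k) * P := by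
    intro k
    have : (P * g * P⁻¹) ^ k = P * g ^ k * P⁻¹ := conj_zpow
    rw [hconj, inv_zpow', ] at this
    rw [this, inv_mul_cancel_right]
  have hno : ∀ n : ℤ, (g ^ n) f0 ≠ P f0 := by
    intro n h
    rcases Int.even_or_odd' n with ⟨j, rfl | rfl⟩
    · have h1 : P ((g ^ j) f0) = (g ^ j) f0 := by
        have : P ((g ^ j) f0) = (g ^ (-j)) (P f0) := by
          rw [← Equiv.Perm.mul_apply, hcz]; rfl
        rw [this, ← h, ← Equiv.Perm.mul_apply, ← zpow_add]
        congr 2; ring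
      exact hp' _ h1
    · have h1 : P ((g ^ j) f0) = (g ^ (j + 1)) f0 := by
        have : P ((g ^ j) f0) = (g ^ (-j)) (P f0) := by
          rw [← Equiv.Perm.mul_apply, hcz]; rfl
        rw [this, ← h, ← Equiv.Perm.mul_apply, ← zpow_add]
        congr 2; ring
      have h2 : (g ^ (j + 1)) f0 = Q (P ((g ^ j) f0)) := by
        rw [add_comm, zpow_add, zpow_one]; rfl
      exact hq' _ (h2.symm.trans h1.symm)
  have hno2 : ∀ k k' : ℤ, (g ^ k) f0 ≠ P ((g ^ k') f0) := by
    intro k k' h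
    apply hno (k' + k)
    rw [zpow_add, Equiv.Perm.mul_apply, h, ← Equiv.Perm.mul_apply P, hcz,
      Equiv.Perm.mul_apply, ← Equiv.Perm.mul_apply, ← zpow_add]
    simp
  let m := Function.minimalPeriod (fun f => g • f) f0
  have hm : 0 < m := by
    apply Function.minimalPeriod_pos_of_mem_periodicPts
    obtain ⟨N, hN, hgN⟩ := isOfFinOrder_iff_pow_eq_one.mp (isOfFinOrder_of_finite g)
    refine ⟨N, hN, ?_⟩
    have : (fun f : F => g • f)^[N] f0 = g ^ N • f0 := by rw [smul_iterate]
    rw [Function.IsPeriodicPt, Function.IsFixedPt, this, hgN, one_smul]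
  have hper : ∀ k k' : ℤ, (g ^ k) f0 = (g ^ k') f0 ↔ (m : ℤ) ∣ k - k' := by
    intro k k'
    rw [← MulAction.zpow_smul_eq_iff_minimalPeriod_dvd, sub_eq_neg_add, zpow_add, mul_smul,
      zpow_neg, inv_smul_eq_iff]
    rfl
  let c : ℤ → F := fun n => if Even n then (g ^ (n / 2)) f0 else P ((g ^ (n / 2)) f0)
  have ce : ∀ k, c (2 * k) = (g ^ k) f0 := by
    intro k; simp [c]
  have co : ∀ k, c (2 * k + 1) = P ((g ^ k) f0) := by
    intro k
    have : (2 * k + 1) / 2 = k := by omega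
    simp [c, this]
  refine ⟨m, c, hm, by simpa using ce 0, fun k => by rw [co, ce]; rfl, fun k => ?_, ?_⟩
  · rw [co, show 2 * k + 2 = 2 * (1 + k) by ring, ce, zpow_add, zpow_one]; rfl
  · intro n n'
    rcases Int.even_or_odd' n with ⟨j, rfl | rfl⟩ <;> rcases Int.even_or_odd' n' with ⟨i, rfl | rfl⟩
    · rw [ce, ce, hper, ← mul_sub, mul_dvd_mul_iff_left (by norm_num)]
    · rw [ce, co]
      refine iff_of_false (hno2 _ _) ?_
      rintro ⟨d, hd⟩
      have : 2 * j - (2 * i + 1) = 2 * (m * d) := by rw [hd]; ring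
      omega
    · rw [ce, co]
      refine iff_of_false (hno2 _ _).symm ?_
      rintro ⟨d, hd⟩
      have : 2 * j + 1 - (2 * i) = 2 * (m * d) := by rw [hd]; ring
      omega
    · rw [co, co, P.apply_eq_iff_eq, hper,
        show 2 * j + 1 - (2 * i + 1) = 2 * (j - i) by ring, mul_dvd_mul_iff_left (by norm_num)]

end Gem

/-- A chart from two quotient descriptions. -/
theorem chart_of_ker {K Y : Type} [TopologicalSpace K] [CompactSpace K] [TopologicalSpace Y]
    [T2Space Y] (A : K → ℂ) (B : K → Y) (hA : Continuous A) (hB : Continuous B)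
    (hr : Set.range A = Metric.closedBall 0 1)
    (hker : ∀ x y, A x = A y ↔ B x = B y) (U : Set Y)
    (hU : ∀ y, y ∈ U ↔ ∃ x, A x ∈ Metric.ball (0 : ℂ) 1 ∧ B x = y) :
    Nonempty (↥U ≃ₜ EuclideanSpace ℝ (Fin 2)) := by
  let A' : K → Metric.closedBall (0 : ℂ) 1 := fun x => ⟨A x, hr ▸ ⟨x, rfl⟩⟩
  have hA' : Continuous A' := hA.subtype_mk _
  have hs : Function.Surjective A' := by
    rintro ⟨z, hz⟩
    rw [← hr] at hz
    obtain ⟨x, rfl⟩ := hz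
    exact ⟨x, rfl⟩
  have hq : Topology.IsQuotientMap A' := hA'.isClosedMap.isQuotientMap hA' hs
  let j : Metric.closedBall (0 : ℂ) 1 → Y := fun z => B (hs z).choose
  have hj : ∀ x, j (A' x) = B x := by
    intro x
    have := (hs (A' x)).choose_spec
    exact (hker _ _).mp (congrArg Subtype.val this)
  have hjc : Continuous j := by
    rw [hq.continuous_iff]
    convert hB using 1
    ext x; exact hj x
  have hji : Function.Injective j := by
    intro z w h
    obtain ⟨x, rfl⟩ := hs z
    obtain ⟨y, rfl⟩ := hs w
    rw [hj, hj] at h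
    exact Subtype.ext ((hker _ _).mpr h)
  have hje : Topology.IsEmbedding j := (hjc.isClosedEmbedding hji).isEmbedding
  let i : Metric.ball (0 : ℂ) 1 → Metric.closedBall (0 : ℂ) 1 :=
    Set.inclusion Metric.ball_subset_closedBall
  have hi : Topology.IsEmbedding i := Topology.IsEmbedding.inclusion _
  have hji : Topology.IsEmbedding (j ∘ i) := hje.comp hi
  have hrange : Set.range (j ∘ i) = U := by
    ext y
    rw [hU]
    constructor
    · rintro ⟨⟨z, hz⟩, rfl⟩
      obtain ⟨x, hx⟩ := hs (i ⟨z, hz⟩)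
      refine ⟨x, ?_, ?_⟩
      · have : A x = z := congrArg Subtype.val hx
        rwa [this]
      · rw [← hj, hx]; rfl
    · rintro ⟨x, hx, rfl⟩
      exact ⟨⟨A x, hx⟩, hj x⟩
  exact ⟨((Homeomorph.setCongr hrange.symm).trans hji.toHomeomorph.symm).trans
    (Homeomorph.unitBall.symm.trans Complex.orthonormalBasisOneI.repr.toHomeomorph)⟩
/-- Polar coordinates with angle measured in units of `π / m`. -/
def polarA (m : ℕ) (r θ : ℝ) : ℂ := r * Complex.exp ((Real.pi * θ / m : ℝ) * Complex.I)

theorem norm_polarA (m : ℕ) (r θ : ℝ) (hr : 0 ≤ r) : ‖polarA m r θ‖ = r := by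
  rw [polarA, norm_mul, Complex.norm_exp_ofReal_mul_I, mul_one, Complex.norm_real,
    Real.norm_of_nonneg hr]

theorem polarA_eq_iff (m : ℕ) (hm : 0 < m) (r r' θ θ' : ℝ) (hr : 0 ≤ r) (hr' : 0 ≤ r') :
    polarA m r θ = polarA m r' θ' ↔ r = r' ∧ (r = 0 ∨ ∃ k : ℤ, θ = θ' + 2 * m * k) := by
  have hm' : (m : ℝ) ≠ 0 := by positivity
  have hpi := Real.pi_ne_zero
  constructor
  · intro h
    have h1 : r = r' := by
      rw [← norm_polarA m r θ hr, h, norm_polarA m r' θ' hr']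
    refine ⟨h1, ?_⟩
    subst h1
    by_cases h0 : r = 0
    · exact Or.inl h0
    right
    have h2 := mul_left_cancel₀ (Complex.ofReal_ne_zero.mpr h0) h
    obtain ⟨k, hk⟩ := Complex.exp_eq_exp_iff_exists_int.mp h2
    refine ⟨k, ?_⟩
    have h3 : (Real.pi * θ / m : ℝ) = (Real.pi * θ' / m : ℝ) + k * (2 * Real.pi) := by
      have : (((Real.pi * θ / m : ℝ) : ℂ)) = ((Real.pi * θ' / m : ℝ) + k * (2 * Real.pi) : ℝ) := by
        apply mul_right_cancel₀ Complex.I_ne_zero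
        rw [hk]; push_cast; ring
      exact_mod_cast this
    field_simp at h3
    linarith
  · rintro ⟨rfl, rfl | ⟨k, rfl⟩⟩
    · simp [polarA]
    · unfold polarA
      congr 1
      rw [Complex.exp_eq_exp_iff_exists_int]
      refine ⟨k, ?_⟩
      have hm'' : (m : ℂ) ≠ 0 := by exact_mod_cast hm.ne'
      push_cast
      field_simp
      try ring

theorem sum_rot (v : Fin 3) (x : Fin 3 → ℝ) : ∑ k, x k = x v + x (v + 1) + x (v + 2) := by
  rw [Fin.sum_univ_three]
  fin_cases v
  · rfl
  · show x 0 + x 1 + x 2 = x 1 + x 2 + x 0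
    ring
  · show x 0 + x 1 + x 2 = x 2 + x 0 + x 1
    ring

theorem rot_cases (v k : Fin 3) : k = v ∨ k = v + 1 ∨ k = v + 2 := by
  revert v k; decide

theorem rot_ne1 (v : Fin 3) : v + 1 ≠ v := by revert v; decide

theorem rot_ne2 (v : Fin 3) : v + 2 ≠ v := by revert v; decide

theorem rot_ne3 (v : Fin 3) : v + 2 ≠ v + 1 := by revert v; decide

/-- Coordinates of the point of the simplex with radius `r` and angle `θ` around `v`. -/
def sectFun (v : Fin 3) (ρ r θ : ℝ) : Fin 3 → ℝ := fun k =>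
  if k = v then 1 - ρ * r else if k = v + 1 then ρ * r * ((1 + Real.cos (θ * Real.pi)) / 2)
    else ρ * r * ((1 - Real.cos (θ * Real.pi)) / 2)

theorem sectFun_v (v : Fin 3) (ρ r θ : ℝ) : sectFun v ρ r θ v = 1 - ρ * r := by
  simp [sectFun]

theorem sectFun_p (v : Fin 3) (ρ r θ : ℝ) :
    sectFun v ρ r θ (v + 1) = ρ * r * ((1 + Real.cos (θ * Real.pi)) / 2) := by
  rw [sectFun, if_neg (rot_ne1 v), if_pos rfl]

theorem sectFun_q (v : Fin 3) (ρ r θ : ℝ) :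
    sectFun v ρ r θ (v + 2) = ρ * r * ((1 - Real.cos (θ * Real.pi)) / 2) := by
  rw [sectFun, if_neg (rot_ne2 v), if_neg (rot_ne3 v)]

theorem continuous_sectFun (v : Fin 3) (ρ : ℝ) :
    Continuous (fun x : Set.Icc (0 : ℝ) 1 × ℝ => sectFun v ρ x.1 x.2) := by
  apply continuous_pi
  intro k
  rcases rot_cases v k with rfl | rfl | rfl
  · simp only [sectFun_v]; fun_prop
  · simp only [sectFun_p]; fun_prop
  · simp only [sectFun_q]; fun_prop

/-- The point of the simplex with radius `r` and angle `θ` around the vertex `v`. -/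
def sect (v : Fin 3) (ρ : ℝ) (hρ : 0 < ρ ∧ ρ < 1) (r : Set.Icc (0 : ℝ) 1) (θ : ℝ) : Delta 2 :=
  ⟨sectFun v ρ r θ, by
    obtain ⟨r, h0, h1⟩ := r
    have hc1 := Real.neg_one_le_cos (θ * Real.pi)
    have hc2 := Real.cos_le_one (θ * Real.pi)
    have hρ0 := hρ.1
    constructor
    · intro k
      rcases rot_cases v k with rfl | rfl | rfl
      · rw [sectFun_v]; nlinarith
      · rw [sectFun_p]
        have : 0 ≤ (1 + Real.cos (θ * Real.pi)) / 2 := by linarith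
        positivity
      · rw [sectFun_q]
        have : 0 ≤ (1 - Real.cos (θ * Real.pi)) / 2 := by linarith
        positivity
    · refine (sum_rot v _).trans ?_
      rw [sectFun_v, sectFun_p, sectFun_q]
      ring⟩

section
variable (v : Fin 3) (ρ : ℝ) (hρ : 0 < ρ ∧ ρ < 1) (r : Set.Icc (0 : ℝ) 1) (θ : ℝ)

theorem sect_v : (sect v ρ hρ r θ).1 v = 1 - ρ * r := sectFun_v _ _ _ _

theorem sect_p : (sect v ρ hρ r θ).1 (v + 1) = ρ * r * ((1 + Real.cos (θ * Real.pi)) / 2) :=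
  sectFun_p _ _ _ _

theorem sect_q : (sect v ρ hρ r θ).1 (v + 2) = ρ * r * ((1 - Real.cos (θ * Real.pi)) / 2) :=
  sectFun_q _ _ _ _

theorem continuous_sect :
    Continuous (fun x : Set.Icc (0 : ℝ) 1 × ℝ => sect v ρ hρ x.1 x.2) := by
  exact (continuous_sectFun v ρ).subtype_mk _

theorem sect_congr (r' : Set.Icc (0 : ℝ) 1) (θ' : ℝ) (h1 : r = r')
    (h : (r : ℝ) = 0 ∨ Real.cos (θ * Real.pi) = Real.cos (θ' * Real.pi)) :
    sect v ρ hρ r θ = sect v ρ hρ r' θ' := by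
  subst h1
  apply Subtype.ext
  funext k
  rcases h with h | h <;> simp [sect, sectFun, h]

theorem delta_ext3 (x y : Delta 2) (h1 : x.1 v = y.1 v) (h2 : x.1 (v + 2) = y.1 (v + 2)) :
    x = y := by
  have hx := x.2.2
  have hy := y.2.2
  rw [sum_rot v] at hx hy
  apply Subtype.ext
  funext k
  rcases rot_cases v k with rfl | rfl | rfl
  · exact h1
  · linarith
  · exact h2

end

theorem cos_even (k : ℤ) : Real.cos (((2 * k : ℤ) : ℝ) * Real.pi) = 1 := by
  rw [Real.cos_int_mul_pi, Even.neg_one_zpow (even_two_mul k)]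

theorem cos_odd (k : ℤ) : Real.cos (((2 * k + 1 : ℤ) : ℝ) * Real.pi) = -1 := by
  rw [Real.cos_int_mul_pi, Odd.neg_one_zpow ⟨k, rfl⟩]

theorem cos_pi_eq {θ θ' : ℝ} (h : Real.cos (θ * Real.pi) = Real.cos (θ' * Real.pi)) :
    ∃ k : ℤ, θ' = 2 * k + θ ∨ θ' = 2 * k - θ := by
  obtain ⟨k, hk⟩ := Real.cos_eq_cos_iff.mp h
  refine ⟨k, ?_⟩
  rcases hk with hk | hk
  · left
    apply mul_right_cancel₀ Real.pi_ne_zero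
    rw [hk]; ring
  · right
    apply mul_right_cancel₀ Real.pi_ne_zero
    rw [hk]; ring

theorem exists_angle (n : ℤ) (s : ℝ) (h1 : -1 ≤ s) (h2 : s ≤ 1) :
    ∃ θ : ℝ, n ≤ θ ∧ θ ≤ n + 1 ∧ Real.cos (θ * Real.pi) = s := by
  have hc : Continuous (fun θ : ℝ => Real.cos (θ * Real.pi)) := by fun_prop
  have hle : (n : ℝ) ≤ n + 1 := by linarith
  rcases Int.even_or_odd' n with ⟨k, hk | hk⟩
  · have e1 : Real.cos ((n : ℝ) * Real.pi) = 1 := by rw [hk, cos_even]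
    have e2 : Real.cos (((n : ℝ) + 1) * Real.pi) = -1 := by
      rw [hk, ← cos_odd k]; push_cast; rfl
    obtain ⟨θ, ⟨ha, hb⟩, h⟩ := intermediate_value_Icc' hle hc.continuousOn
      (show s ∈ Set.Icc _ _ by rw [e1, e2]; exact ⟨h1, h2⟩)
    exact ⟨θ, ha, hb, h⟩
  · have e1 : Real.cos ((n : ℝ) * Real.pi) = -1 := by rw [hk, cos_odd]
    have e2 : Real.cos (((n : ℝ) + 1) * Real.pi) = 1 := by
      rw [hk]; refine Eq.trans ?_ (cos_even (k + 1)); push_cast; congr 1; ring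
    obtain ⟨θ, ⟨ha, hb⟩, h⟩ := intermediate_value_Icc hle hc.continuousOn
      (show s ∈ Set.Icc _ _ by rw [e1, e2]; exact ⟨h1, h2⟩)
    exact ⟨θ, ha, hb, h⟩

section Star

variable {F : Type} (a : Fin 3 → F → F) (v : Fin 3) (ρ : ℝ) (c : ℤ → F)

/-- Polar parametrisation of the star of a vertex. -/
def polarB (hρ : 0 < ρ ∧ ρ < 1) (x : Set.Icc (0 : ℝ) 1 × ℝ) : GemSpace a :=
  gmk a (c ⌊x.2⌋) (sect v ρ hρ x.1 x.2)

theorem polarB_eq (hρ : 0 < ρ ∧ ρ < 1)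
    (hc1 : ∀ k, c (2 * k + 1) = a (v + 1) (c (2 * k)))
    (hc2 : ∀ k, c (2 * k + 2) = a (v + 2) (c (2 * k + 1))) (r : Set.Icc (0 : ℝ) 1) (n : ℤ) (θ : ℝ) (h1 : n ≤ θ) (h2 : θ ≤ n + 1) :
    polarB a v ρ c hρ (r, θ) = gmk a (c n) (sect v ρ hρ r θ) := by
  rcases h2.lt_or_eq with h2 | h2
  · have : ⌊θ⌋ = n := Int.floor_eq_iff.mpr ⟨h1, h2⟩
    simp [polarB, this]
  · have hfl : ⌊θ⌋ = n + 1 := by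
      rw [h2]; simp
    simp only [polarB, hfl]
    rcases Int.even_or_odd' n with ⟨k, hk | hk⟩
    · rw [hk, hc1]
      apply gmk_step
      rw [sect_p]
      have := cos_odd k
      rw [h2, hk]
      push_cast at this ⊢
      rw [this]; ring
    · rw [hk, show 2 * k + 1 + 1 = 2 * k + 2 by ring, hc2]
      apply gmk_step
      rw [sect_q]
      have := cos_even (k + 1)
      rw [h2, hk]
      push_cast at this ⊢
      rw [show 2 * (k : ℝ) + 1 + 1 = 2 * (k + 1) by ring, this]; ring

theorem continuous_polarB (hρ : 0 < ρ ∧ ρ < 1)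
    (hc1 : ∀ k, c (2 * k + 1) = a (v + 1) (c (2 * k)))
    (hc2 : ∀ k, c (2 * k + 2) = a (v + 2) (c (2 * k + 1))) : Continuous (polarB a v ρ c hρ) := by
  let C : ℤ → Set (Set.Icc (0 : ℝ) 1 × ℝ) := fun n => Prod.snd ⁻¹' (Set.Icc (n : ℝ) (n + 1))
  have hlf : LocallyFinite C := by
    intro x
    refine ⟨Prod.snd ⁻¹' (Set.Ioo (x.2 - 1) (x.2 + 1)),
      (isOpen_Ioo.preimage continuous_snd).mem_nhds (by simp), ?_⟩
    refine (Set.finite_Icc (⌊x.2⌋ - 3) (⌊x.2⌋ + 3)).subset ?_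
    rintro n ⟨y, ⟨h1, h2⟩, h3, h4⟩
    have h5 := Int.floor_le x.2
    have h6 := Int.lt_floor_add_one x.2
    constructor
    · have : ((⌊x.2⌋ - 3 : ℤ) : ℝ) ≤ n := by push_cast; linarith
      exact_mod_cast this
    · have : (n : ℝ) ≤ ((⌊x.2⌋ + 3 : ℤ) : ℝ) := by push_cast; linarith
      exact_mod_cast this
  refine hlf.continuous ?_ (fun n => isClosed_Icc.preimage continuous_snd) ?_
  · ext x
    simp only [Set.mem_iUnion, Set.mem_univ, iff_true]
    exact ⟨⌊x.2⌋, Int.floor_le _, (Int.lt_floor_add_one _).le⟩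
  · intro n
    refine ((continuous_gmk a (c n)).comp (continuous_sect v ρ hρ)).continuousOn.congr ?_
    rintro ⟨r, θ⟩ ⟨h1, h2⟩
    exact polarB_eq a v ρ c hρ hc1 hc2 r n θ h1 h2

theorem gmk_zero
    (hc1 : ∀ k, c (2 * k + 1) = a (v + 1) (c (2 * k)))
    (hc2 : ∀ k, c (2 * k + 2) = a (v + 2) (c (2 * k + 1))) (t : Delta 2) (hp : t.1 (v + 1) = 0) (hq : t.1 (v + 2) = 0) (n : ℤ) :
    gmk a (c n) t = gmk a (c 0) t := by
  have step : ∀ n, gmk a (c (n + 1)) t = gmk a (c n) t := by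
    intro n
    rcases Int.even_or_odd' n with ⟨k, rfl | rfl⟩
    · rw [hc1]; exact gmk_step _ _ _ _ hp
    · rw [show 2 * k + 1 + 1 = 2 * k + 2 by ring, hc2]; exact gmk_step _ _ _ _ hq
  induction n using Int.induction_on with
  | zero => rfl
  | succ i ih => rw [step, ih]
  | pred i ih => rw [← ih, ← step]; simp

theorem polar_ker (hρ : 0 < ρ ∧ ρ < 1)
    (hc1 : ∀ k, c (2 * k + 1) = a (v + 1) (c (2 * k)))
    (hc2 : ∀ k, c (2 * k + 2) = a (v + 2) (c (2 * k + 1)))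
    (ha : ∀ k f, a k (a k f) = f) (m : ℕ) (hm : 0 < m)
    (hc3 : ∀ n n', c n = c n' ↔ (2 * m : ℤ) ∣ n - n') (r r' : Set.Icc (0 : ℝ) 1) (θ θ' : ℝ) :
    polarA m r θ = polarA m r' θ' ↔ polarB a v ρ c hρ (r, θ) = polarB a v ρ c hρ (r', θ') := by
  rw [polarA_eq_iff m hm _ _ _ _ r.2.1 r'.2.1]
  constructor
  · rintro ⟨h1, h2⟩
    have h1 : r = r' := Subtype.ext h1
    subst h1
    rcases h2 with h2 | ⟨k, rfl⟩
    · have : sect v ρ hρ r θ = sect v ρ hρ r θ' := sect_congr _ _ _ _ _ _ _ rfl (Or.inl h2)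
      simp only [polarB, this]
      rw [gmk_zero a v c hc1 hc2, gmk_zero a v c hc1 hc2 _ _ _ ⌊θ'⌋]
      all_goals simp [sect_p, sect_q, h2]
    · have e1 : sect v ρ hρ r (θ' + 2 * m * k) = sect v ρ hρ r θ' := by
        apply sect_congr _ _ _ _ _ _ _ rfl (Or.inr _)
        rw [show (θ' + 2 * m * k) * Real.pi = θ' * Real.pi + ((m * k : ℤ) : ℝ) * (2 * Real.pi) by
          push_cast; ring, Real.cos_add_int_mul_two_pi]
      have e2 : ⌊θ' + 2 * m * k⌋ = ⌊θ'⌋ + 2 * m * k := by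
        rw [← Int.floor_add_intCast]; push_cast; rfl
      have e3 : c (⌊θ'⌋ + 2 * m * k) = c ⌊θ'⌋ := by
        rw [hc3]; exact ⟨k, by ring⟩
      simp only [polarB, e1, e2, e3]
  · intro h
    obtain ⟨h1, h2⟩ := gmk_eq a ha h
    have hr : (r : ℝ) = r' := by
      have := congrArg (fun t : Delta 2 => t.1 v) h1
      simp only [sect_v] at this
      have h3 : ρ * (r : ℝ) = ρ * r' := by linarith
      exact mul_left_cancel₀ hρ.1.ne' h3
    refine ⟨hr, ?_⟩
    by_cases hr0 : (r : ℝ) = 0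
    · exact Or.inl hr0
    right
    have hρr : ρ * (r : ℝ) ≠ 0 := mul_ne_zero hρ.1.ne' hr0
    have hv0 : 1 - ρ * (r : ℝ) ≠ 0 := by
      have := r.2.2
      have := r.2.1
      nlinarith [hρ.1, hρ.2]
    have hcos : Real.cos (θ * Real.pi) = Real.cos (θ' * Real.pi) := by
      have := congrArg (fun t : Delta 2 => t.1 (v + 2)) h1
      simp only [sect_q, ← hr] at this
      have := mul_left_cancel₀ hρr this
      linarith
    obtain ⟨k, hk⟩ := cos_pi_eq hcos
    by_cases hisInt : ∃ n : ℤ, θ = n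
    · obtain ⟨n, rfl⟩ := hisInt
      obtain ⟨n', hn', k', hk'⟩ : ∃ n' : ℤ, θ' = n' ∧ ∃ k' : ℤ, n' = n + 2 * k' := by
        rcases hk with hk | hk
        · exact ⟨2 * k + n, by rw [hk]; push_cast; ring, k, by ring⟩
        · exact ⟨2 * k - n, by rw [hk]; push_cast; ring, k - n, by ring⟩
      subst hn'
      have hmem : c ⌊((n' : ℤ) : ℝ)⌋ ∈ ({c n, c (n - 1)} : Set F) := by
        apply h2 {c n, c (n - 1)}
        · intro l hl g hg
          rcases Int.even_or_odd' n with ⟨j, rfl | rfl⟩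
          · rcases rot_cases v l with rfl | rfl | rfl
            · rw [sect_v] at hl; exact absurd hl hv0
            · rw [sect_p, cos_even] at hl; exfalso; apply hρr; linarith
            · have := hc2 (j - 1)
              rw [show 2 * (j - 1) + 2 = 2 * j by ring,
                show 2 * (j - 1) + 1 = 2 * j - 1 by ring] at this
              rcases hg with rfl | rfl
              · right; show _ = _; rw [this, ha]
              · left; exact this.symm
          · rcases rot_cases v l with rfl | rfl | rfl
            · rw [sect_v] at hl; exact absurd hl hv0
            · have := hc1 j
              rw [show 2 * j + 1 - 1 = 2 * j by ring] at hg ⊢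
              rcases hg with rfl | rfl
              · right; show _ = _; rw [this, ha]
              · left; exact this.symm
            · rw [sect_q, cos_odd] at hl; exfalso; apply hρr; linarith
        · left; simp
      rw [Int.floor_intCast] at hmem
      rcases hmem with h3 | h3
      · obtain ⟨d, hd⟩ := (hc3 _ _).mp h3
        refine ⟨-d, ?_⟩
        have : n = n' + 2 * m * (-d) := by linarith
        rw [this]; push_cast; ring
      · exfalso
        obtain ⟨d, hd⟩ := (hc3 _ _).mp h3
        have : n' - (n - 1) = 2 * (m * d) := by rw [hd]; ring
        omega
    · have hc' : Real.cos (θ * Real.pi) ≠ 1 ∧ Real.cos (θ * Real.pi) ≠ -1 := by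
        constructor
        · intro h
          have h' : Real.cos (θ * Real.pi) = Real.cos (0 * Real.pi) := by simp [h]
          obtain ⟨j, hj | hj⟩ := cos_pi_eq h'
          · exact hisInt ⟨-2 * j, by push_cast; linarith⟩
          · exact hisInt ⟨2 * j, by push_cast; linarith⟩
        · intro h
          have h' : Real.cos (θ * Real.pi) = Real.cos (1 * Real.pi) := by simp [h]
          obtain ⟨j, hj | hj⟩ := cos_pi_eq h'
          · exact hisInt ⟨1 - 2 * j, by push_cast; linarith⟩
          · exact hisInt ⟨2 * j - 1, by push_cast; linarith⟩
      have hmem : c ⌊θ'⌋ ∈ ({c ⌊θ⌋} : Set F) := by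
        apply h2 {c ⌊θ⌋}
        · intro l hl g hg
          exfalso
          rcases rot_cases v l with rfl | rfl | rfl
          · rw [sect_v] at hl; exact absurd hl hv0
          · rw [sect_p] at hl
            rcases mul_eq_zero.mp hl with h | h
            · exact hρr h
            · exact hc'.2 (by linarith)
          · rw [sect_q] at hl
            rcases mul_eq_zero.mp hl with h | h
            · exact hρr h
            · exact hc'.1 (by linarith)
        · rfl
      obtain ⟨d, hd⟩ := (hc3 _ _).mp hmem
      rcases hk with hk | hk
      · have : ⌊θ'⌋ = 2 * k + ⌊θ⌋ := by
          rw [hk, show (2 * (k : ℝ) + θ) = ((2 * k : ℤ) : ℝ) + θ by push_cast; ring,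
            Int.floor_intCast_add]
        have hkd : 2 * k = 2 * m * d := by linarith
        have hkd' : 2 * (k : ℝ) = 2 * m * d := by exact_mod_cast hkd
        exact ⟨-d, by rw [hk, hkd']; push_cast; ring⟩
      · exfalso
        have : ⌊θ'⌋ = 2 * k - ⌊θ⌋ - 1 := by
          rw [Int.floor_eq_iff, hk]
          have h5 := Int.floor_le θ
          have h6 := Int.lt_floor_add_one θ
          have h7 : (⌊θ⌋ : ℝ) ≠ θ := fun h => hisInt ⟨_, h.symm⟩
          have h8 := lt_of_le_of_ne h5 h7
          push_cast
          constructor <;> linarith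
        have h9 : ⌊θ'⌋ - ⌊θ⌋ = 2 * (m * d) := by rw [hd]; ring
        omega

theorem star_chart
    (hρ : 0 < ρ ∧ ρ < 1)
    (hc1 : ∀ k, c (2 * k + 1) = a (v + 1) (c (2 * k)))
    (hc2 : ∀ k, c (2 * k + 2) = a (v + 2) (c (2 * k + 1)))
    (ha : ∀ k f, a k (a k f) = f) (m : ℕ) (hm : 0 < m)
    (hc3 : ∀ n n', c n = c n' ↔ (2 * m : ℤ) ∣ n - n') :
    Nonempty (↥{y : GemSpace a | ∃ f ∈ Set.range c, ∃ t ∈ {t : Delta 2 | 1 - ρ < t.1 v},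
      gmk a f t = y} ≃ₜ EuclideanSpace ℝ (Fin 2)) := by
  have : T2Space (GemSpace a) := gem_t2 a ha
  have hmR : (0 : ℝ) < m := by exact_mod_cast hm
  have hsurj : ∀ z ∈ Metric.closedBall (0 : ℂ) 1,
      ∃ x : Set.Icc (0 : ℝ) 1 × Set.Icc (-m : ℝ) m, polarA m x.1 x.2 = z := by
    intro z hz
    have hz : ‖z‖ ≤ 1 := by simpa using hz
    have h1 := Complex.neg_pi_lt_arg z
    have h2 := Complex.arg_le_pi z
    have hpi := Real.pi_pos
    refine ⟨(⟨‖z‖, norm_nonneg _, hz⟩, ⟨m * z.arg / Real.pi, ?_, ?_⟩), ?_⟩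
    · rw [le_div_iff₀ hpi]; nlinarith
    · rw [div_le_iff₀ hpi]; nlinarith
    · simp only [polarA]
      rw [show Real.pi * (m * z.arg / Real.pi) / m = z.arg by field_simp]
      exact Complex.norm_mul_exp_arg_mul_I z
  refine chart_of_ker (K := Set.Icc (0 : ℝ) 1 × Set.Icc (-m : ℝ) m)
    (fun x => polarA m x.1 x.2) (fun x => polarB a v ρ c hρ (x.1, x.2)) ?_ ?_ ?_ ?_ _ ?_
  · unfold polarA; fun_prop
  · exact (continuous_polarB a v ρ c hρ hc1 hc2).comp (by fun_prop)
  · ext z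
    constructor
    · rintro ⟨x, rfl⟩
      simpa [norm_polarA m _ _ x.1.2.1] using x.1.2.2
    · intro hz
      exact hsurj z hz
  · intro x y
    exact polar_ker a v ρ c hρ hc1 hc2 ha m hm hc3 _ _ _ _
  · intro y
    constructor
    · rintro ⟨_, ⟨n, rfl⟩, t, ht, rfl⟩
      have ht : 1 - ρ < t.1 v := ht
      have hsum := t.2.2
      rw [sum_rot v] at hsum
      have tv := t.2.1 v
      have tp := t.2.1 (v + 1)
      have tq := t.2.1 (v + 2)
      have hρ0 := hρ.1
      have hR1 : (1 - t.1 v) / ρ < 1 := by rw [div_lt_one hρ0]; linarith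
      let R : Set.Icc (0 : ℝ) 1 := ⟨(1 - t.1 v) / ρ, by apply div_nonneg <;> linarith, hR1.le⟩
      have hR : ρ * (R : ℝ) = 1 - t.1 v := by
        show ρ * ((1 - t.1 v) / ρ) = _
        field_simp
      obtain ⟨θ, hθ⟩ : ∃ θ : ℝ, polarB a v ρ c hρ (R, θ) = gmk a (c n) t := by
        by_cases h0 : 1 - t.1 v = 0
        · refine ⟨n, ?_⟩
          rw [polarB_eq a v ρ c hρ hc1 hc2 R n n le_rfl (by linarith)]
          congr 1
          apply delta_ext3 v
          · rw [sect_v]; linarith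
          · rw [sect_q, hR, h0]; linarith
        · have hpos : 0 < 1 - t.1 v := lt_of_le_of_ne (by linarith) (Ne.symm h0)
          obtain ⟨θ, h1, h2, h3⟩ := exists_angle n (1 - 2 * (t.1 (v + 2) / (1 - t.1 v)))
            (by
              have : t.1 (v + 2) / (1 - t.1 v) ≤ 1 := by rw [div_le_one hpos]; linarith
              linarith)
            (by
              have : 0 ≤ t.1 (v + 2) / (1 - t.1 v) := by positivity
              linarith)
          refine ⟨θ, ?_⟩
          rw [polarB_eq a v ρ c hρ hc1 hc2 R n θ h1 h2]
          congr 1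
          apply delta_ext3 v
          · rw [sect_v]; linarith
          · rw [sect_q, hR, h3]; field_simp; ring
      have hnorm : ‖polarA m R θ‖ = R := norm_polarA m _ _ R.2.1
      obtain ⟨x, hx⟩ := hsurj (polarA m R θ) (by simpa [hnorm] using R.2.2)
      refine ⟨x, ?_, ?_⟩
      · show polarA m x.1 x.2 ∈ _
        rw [hx, mem_ball_zero_iff, hnorm]
        exact hR1
      · rw [← hθ]
        exact (polar_ker a v ρ c hρ hc1 hc2 ha m hm hc3 _ _ _ _).mp hx
    · rintro ⟨x, hx, rfl⟩
      refine ⟨_, ⟨_, rfl⟩, _, ?_, rfl⟩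
      have hx : (x.1 : ℝ) < 1 := by simpa [norm_polarA m _ _ x.1.2.1] using hx
      show 1 - ρ < _
      rw [sect_v]
      nlinarith [hρ.1]

end Star

theorem gem_locEuclidean {F : Type} [Finite F] (a : Fin 3 → F → F)
    (ha : ∀ k f, a k (a k f) = f) (hne : ∀ k f, a k f ≠ f) : LocEuclidean 2 (GemSpace a) := by
  rintro ⟨f0, t0⟩
  obtain ⟨v, hv⟩ : ∃ v, 0 < t0.1 v := by
    by_contra! h
    have h1 := t0.2.2
    have h2 : ∑ v, t0.1 v ≤ 0 := Finset.sum_nonpos fun v _ => h v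
    linarith
  have hv1 : t0.1 v ≤ 1 := by
    have := t0.2.2
    rw [sum_rot v] at this
    linarith [t0.2.1 (v + 1), t0.2.1 (v + 2)]
  obtain ⟨m, c, hm, hc0, hc1, hc2, hc3⟩ := exists_cycle (a (v + 1)) (a (v + 2)) (ha _) (ha _)
    (hne _) (hne _) f0
  have hρ : 0 < 1 - t0.1 v / 2 ∧ 1 - t0.1 v / 2 < 1 := by constructor <;> linarith
  refine ⟨_, ?_, ?_, star_chart a v _ c hρ hc1 hc2 ha m hm hc3⟩
  · apply gem_isOpen a _ _ _ _ ha
    · exact isOpen_lt continuous_const ((continuous_apply v).comp continuous_subtype_val)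
    · rintro k t ht hk _ ⟨n, rfl⟩
      have ht : 1 - (1 - t0.1 v / 2) < t.1 v := ht
      rcases rot_cases v k with rfl | rfl | rfl
      · linarith
      · rcases Int.even_or_odd' n with ⟨j, rfl | rfl⟩
        · exact ⟨_, hc1 j⟩
        · exact ⟨2 * j, by rw [hc1, ha]⟩
      · rcases Int.even_or_odd' n with ⟨j, rfl | rfl⟩
        · refine ⟨2 * (j - 1) + 1, ?_⟩
          have := hc2 (j - 1)
          rw [show 2 * (j - 1) + 2 = 2 * j by ring] at this
          rw [this, ha]
        · exact ⟨_, hc2 j⟩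
  · refine ⟨f0, ⟨0, hc0⟩, t0, ?_, rfl⟩
    show 1 - (1 - t0.1 v / 2) < _
    linarith
/-! ### Barycentric subdivision -/

section Subdivision

/-- Sorted barycentric coordinates from coordinates in the flag triangle. -/
def baryW (t : Fin 3 → ℝ) : Fin 3 → ℝ :=
  ![t 0 + t 1 / 2 + t 2 / 3, t 1 / 2 + t 2 / 3, t 2 / 3]

theorem delta_comp (x : Delta 2) (e : Equiv.Perm (Fin 3)) :
    (∀ v, 0 ≤ (x.1 ∘ e) v) ∧ ∑ v, (x.1 ∘ e) v = 1 :=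
  ⟨fun _ => x.2.1 _, (Equiv.sum_comp e x.1).trans x.2.2⟩

/-- `baryW` as a map of simplices. -/
def baryD (t : Delta 2) : Delta 2 :=
  ⟨baryW t.1, by
    have h0 := t.2.1 0
    have h1 := t.2.1 1
    have h2 := t.2.1 2
    constructor
    · intro v
      fin_cases v
      · show 0 ≤ t.1 0 + t.1 1 / 2 + t.1 2 / 3
        positivity
      · show 0 ≤ t.1 1 / 2 + t.1 2 / 3
        positivity
      · show 0 ≤ t.1 2 / 3
        positivity
    · have hs := t.2.2
      rw [Fin.sum_univ_three] at hs ⊢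
      show t.1 0 + t.1 1 / 2 + t.1 2 / 3 + (t.1 1 / 2 + t.1 2 / 3) + t.1 2 / 3 = 1
      linarith⟩

/-- TFlag coordinates from sorted barycentric coordinates. -/
def flagD (x : Delta 2) (h : x.1 1 ≤ x.1 0 ∧ x.1 2 ≤ x.1 1) : Delta 2 :=
  ⟨![x.1 0 - x.1 1, 2 * (x.1 1 - x.1 2), 3 * x.1 2], by
    have h2 := x.2.1 2
    constructor
    · intro v
      fin_cases v
      · show 0 ≤ x.1 0 - x.1 1
        linarith
      · show 0 ≤ 2 * (x.1 1 - x.1 2)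
        linarith
      · show 0 ≤ 3 * x.1 2
        linarith
    · have hs := x.2.2
      rw [Fin.sum_univ_three] at hs ⊢
      show x.1 0 - x.1 1 + 2 * (x.1 1 - x.1 2) + 3 * x.1 2 = 1
      linarith⟩

theorem baryD_flagD (x : Delta 2) (h : x.1 1 ≤ x.1 0 ∧ x.1 2 ≤ x.1 1) :
    baryD (flagD x h) = x := by
  apply Subtype.ext
  funext k
  fin_cases k
  · show x.1 0 - x.1 1 + 2 * (x.1 1 - x.1 2) / 2 + 3 * x.1 2 / 3 = x.1 0
    ring
  · show 2 * (x.1 1 - x.1 2) / 2 + 3 * x.1 2 / 3 = x.1 1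
    ring
  · show 3 * x.1 2 / 3 = x.1 2
    ring

theorem baryD_inj {s t : Delta 2} (h : baryD s = baryD t) : s = t := by
  have e : ∀ k, (baryD s).1 k = (baryD t).1 k := fun k => by rw [h]
  have e0 : s.1 0 + s.1 1 / 2 + s.1 2 / 3 = t.1 0 + t.1 1 / 2 + t.1 2 / 3 := e 0
  have e1 : s.1 1 / 2 + s.1 2 / 3 = t.1 1 / 2 + t.1 2 / 3 := e 1
  have e2 : s.1 2 / 3 = t.1 2 / 3 := e 2
  apply Subtype.ext
  funext k
  fin_cases k
  · show s.1 0 = t.1 0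
    linarith
  · show s.1 1 = t.1 1
    linarith
  · show s.1 2 = t.1 2
    linarith

theorem baryD_sorted (t : Delta 2) :
    (baryD t).1 1 ≤ (baryD t).1 0 ∧ (baryD t).1 2 ≤ (baryD t).1 1 := by
  have h0 := t.2.1 0
  have h1 := t.2.1 1
  constructor
  · show t.1 1 / 2 + t.1 2 / 3 ≤ t.1 0 + t.1 1 / 2 + t.1 2 / 3
    linarith
  · show t.1 2 / 3 ≤ t.1 1 / 2 + t.1 2 / 3
    linarith

theorem continuous_baryD : Continuous baryD := by
  apply Continuous.subtype_mk
  apply continuous_pi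
  have hc : ∀ k : Fin 3, Continuous (fun t : Delta 2 => t.1 k) := fun k =>
    (continuous_apply k).comp continuous_subtype_val
  have h0 := hc 0
  have h1 := hc 1
  have h2 := hc 2
  intro k
  fin_cases k
  · exact (h0.add (h1.div_const 2)).add (h2.div_const 3)
  · exact (h1.div_const 2).add (h2.div_const 3)
  · exact h2.div_const 3

theorem exists_sort (x : Fin 3 → ℝ) :
    ∃ σ : Equiv.Perm (Fin 3), x (σ 1) ≤ x (σ 0) ∧ x (σ 2) ≤ x (σ 1) := by
  have h := Tuple.monotone_sort (fun k => - x k)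
  refine ⟨Tuple.sort (fun k => - x k), ?_, ?_⟩
  · have := h (show (0 : Fin 3) ≤ 1 by decide)
    simpa using this
  · have := h (show (1 : Fin 3) ≤ 2 by decide)
    simpa using this

/-- If `k` is a minimum of `x`, one may sort with `k` last. -/
theorem exists_sort_last (x : Fin 3 → ℝ) (k : Fin 3) (hk : ∀ l, x k ≤ x l) :
    ∃ σ : Equiv.Perm (Fin 3), σ 2 = k ∧ x (σ 1) ≤ x (σ 0) ∧ x (σ 2) ≤ x (σ 1) := by
  have hσ : ∃ σ : Equiv.Perm (Fin 3), σ 2 = k := ⟨Equiv.swap 2 k, Equiv.swap_apply_left _ _⟩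
  obtain ⟨σ, hσ⟩ := hσ
  rcases le_total (x (σ 1)) (x (σ 0)) with h | h
  · exact ⟨σ, hσ, h, by rw [hσ]; exact hk _⟩
  · have e2 : (σ * Equiv.swap 0 1 : Equiv.Perm (Fin 3)) 2 = k := by
      rw [Equiv.Perm.mul_apply, show Equiv.swap (0 : Fin 3) 1 2 = 2 by decide, hσ]
    refine ⟨σ * Equiv.swap 0 1, e2, ?_, ?_⟩
    · simpa using h
    · rw [e2]; exact hk _

variable (D : GlueingDatum 2)

/-- The flags. -/
abbrev TFlag : Type := D.I × Equiv.Perm (Fin 3)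

/-- The three involutions on flags. -/
def flagInv (k : Fin 3) (f : TFlag D) : TFlag D :=
  match k with
  | 0 => (f.1, f.2 * Equiv.swap 0 1)
  | 1 => (f.1, f.2 * Equiv.swap 1 2)
  | 2 => ((D.P (f.1, f.2 2)).1, D.glue (f.1, f.2 2) * f.2)

theorem flagInv_invol (k : Fin 3) (f : TFlag D) : flagInv D k (flagInv D k f) = f := by
  obtain ⟨i, σ⟩ := f
  fin_cases k
  · show (i, σ * Equiv.swap 0 1 * Equiv.swap 0 1) = (i, σ)
    rw [mul_assoc, Equiv.swap_mul_self, mul_one]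
  · show (i, σ * Equiv.swap 1 2 * Equiv.swap 1 2) = (i, σ)
    rw [mul_assoc, Equiv.swap_mul_self, mul_one]
  · show ((D.P ((D.P (i, σ 2)).1, D.glue (i, σ 2) (σ 2))).1,
      D.glue ((D.P (i, σ 2)).1, D.glue (i, σ 2) (σ 2)) * (D.glue (i, σ 2) * σ)) = (i, σ)
    have h : ((D.P (i, σ 2)).1, D.glue (i, σ 2) (σ 2)) = D.P (i, σ 2) :=
      Prod.ext rfl (D.glue_face (i, σ 2))
    rw [h, D.P_involutive, D.glue_symm]
    congr 1
    ext k
    simp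

theorem flagInv_ne (k : Fin 3) (f : TFlag D) : flagInv D k f ≠ f := by
  obtain ⟨i, σ⟩ := f
  intro h
  fin_cases k
  · have h2 : σ * Equiv.swap 0 1 = σ := congrArg Prod.snd h
    have h3 : Equiv.swap (0 : Fin 3) 1 = 1 := mul_eq_left.mp h2
    exact absurd h3 (by decide)
  · have h2 : σ * Equiv.swap 1 2 = σ := congrArg Prod.snd h
    have h3 : Equiv.swap (1 : Fin 3) 2 = 1 := mul_eq_left.mp h2
    exact absurd h3 (by decide)
  · have h1 : (D.P (i, σ 2)).1 = i := congrArg Prod.fst h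
    have h2 : D.glue (i, σ 2) * σ = σ := congrArg Prod.snd h
    have h3 : D.glue (i, σ 2) = 1 := mul_eq_right.mp h2
    apply D.P_fixedPointFree (i, σ 2)
    have h4 := D.glue_face (i, σ 2)
    rw [h3] at h4
    exact Prod.ext h1 h4.symm

/-- The map from flag triangles to triangles. -/
def flagMap (x : Σ _ : TFlag D, Delta 2) : GlueTotal D :=
  ⟨x.1.1, ⟨(baryD x.2).1 ∘ x.1.2.symm, delta_comp (baryD x.2) x.1.2.symm⟩⟩

theorem continuous_flagMap : Continuous (flagMap D) := by
  rw [continuous_sigma_iff]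
  intro f
  have h : Continuous (fun t : Delta 2 =>
      (⟨(baryD t).1 ∘ f.2.symm, delta_comp (baryD t) f.2.symm⟩ : Delta 2)) := by
    refine Continuous.subtype_mk ?_ _
    refine continuous_pi fun k => ?_
    exact (continuous_apply _).comp (continuous_subtype_val.comp continuous_baryD)
  exact (continuous_sigmaMk (σ := fun _ : D.I => Delta 2) (i := f.1)).comp h

theorem glueTotal_ext {p q : GlueTotal D} (h1 : p.1 = q.1) (h2 : p.2.1 = q.2.1) : p = q := by
  obtain ⟨i, x⟩ := p
  obtain ⟨j, y⟩ := q
  obtain rfl : i = j := h1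
  obtain rfl : x = y := Subtype.ext h2
  rfl

/-- A sorted point comes from a flag. -/
theorem flagMap_of_sorted (i : D.I) (x : Delta 2) (σ : Equiv.Perm (Fin 3))
    (h : x.1 (σ 1) ≤ x.1 (σ 0) ∧ x.1 (σ 2) ≤ x.1 (σ 1)) :
    ∃ t, (baryD t).1 = x.1 ∘ σ ∧ flagMap D ⟨(i, σ), t⟩ = ⟨i, x⟩ := by
  refine ⟨flagD ⟨x.1 ∘ σ, delta_comp x σ⟩ h, by rw [baryD_flagD], ?_⟩
  apply glueTotal_ext
  · rfl
  · simp only [flagMap, baryD_flagD]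
    funext k
    simp

theorem perm_three (τ : Equiv.Perm (Fin 3)) :
    (τ = 1 ∧ τ 0 = 0 ∧ τ 1 = 1 ∧ τ 2 = 2) ∨
    (τ = Equiv.swap 0 1 ∧ τ 0 = 1 ∧ τ 1 = 0 ∧ τ 2 = 2) ∨
    (τ = Equiv.swap 1 2 ∧ τ 0 = 0 ∧ τ 1 = 2 ∧ τ 2 = 1) ∨
    (τ = Equiv.swap 0 1 * Equiv.swap 1 2 ∧ τ 0 = 1 ∧ τ 1 = 2 ∧ τ 2 = 0) ∨
    (τ = Equiv.swap 1 2 * Equiv.swap 0 1 ∧ τ 0 = 2 ∧ τ 1 = 0 ∧ τ 2 = 1) ∨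
    (τ = Equiv.swap 0 1 * Equiv.swap 1 2 * Equiv.swap 0 1 ∧ τ 0 = 2 ∧ τ 1 = 1 ∧ τ 2 = 0) := by
  revert τ; decide

theorem flag_step0 (i : D.I) (σ : Equiv.Perm (Fin 3)) (t : Delta 2)
    (h : (baryD t).1 0 = (baryD t).1 1) :
    gmk (flagInv D) (i, σ * Equiv.swap 0 1) t = gmk (flagInv D) (i, σ) t := by
  have h' : t.1 0 + t.1 1 / 2 + t.1 2 / 3 = t.1 1 / 2 + t.1 2 / 3 := h
  exact gmk_step (flagInv D) (i, σ) t 0 (by linarith)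

theorem flag_step1 (i : D.I) (σ : Equiv.Perm (Fin 3)) (t : Delta 2)
    (h : (baryD t).1 1 = (baryD t).1 2) :
    gmk (flagInv D) (i, σ * Equiv.swap 1 2) t = gmk (flagInv D) (i, σ) t := by
  have h' : t.1 1 / 2 + t.1 2 / 3 = t.1 2 / 3 := h
  exact gmk_step (flagInv D) (i, σ) t 1 (by linarith)

theorem delta_ext_fin {x y : Delta 2} (h0 : x.1 0 = y.1 0) (h1 : x.1 1 = y.1 1)
    (h2 : x.1 2 = y.1 2) : x = y := by
  apply Subtype.ext
  funext k
  fin_cases k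
  · exact h0
  · exact h1
  · exact h2

/-- Flags with the same image in a triangle are equivalent. -/
theorem flag_unique (i : D.I) (σ σ' : Equiv.Perm (Fin 3)) (t t' : Delta 2)
    (h : (baryD t).1 ∘ σ.symm = (baryD t').1 ∘ σ'.symm) :
    gmk (flagInv D) (i, σ) t = gmk (flagInv D) (i, σ') t' := by
  obtain ⟨τ, rfl⟩ : ∃ τ, σ' = σ * τ := ⟨σ⁻¹ * σ', by simp⟩
  have h' : ∀ k : Fin 3, (baryD t').1 k = (baryD t).1 (τ k) := by
    intro k
    have := congrFun h (σ (τ k))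
    have e1 : σ.symm (σ (τ k)) = τ k := by simp
    have e2 : (σ * τ).symm (σ (τ k)) = k := by
      rw [Equiv.symm_apply_eq]; rfl
    simp only [Function.comp_apply] at this
    rw [e1, e2] at this
    exact this.symm
  have hs := baryD_sorted t
  have hs' := baryD_sorted t'
  have e0 := h' 0
  have e1 := h' 1
  have e2 := h' 2
  obtain ⟨hs1, hs2⟩ := hs
  obtain ⟨hs3, hs4⟩ := hs'
  rcases perm_three τ with ⟨hτ, h0, h1, h2⟩ | ⟨hτ, h0, h1, h2⟩ | ⟨hτ, h0, h1, h2⟩ |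
    ⟨hτ, h0, h1, h2⟩ | ⟨hτ, h0, h1, h2⟩ | ⟨hτ, h0, h1, h2⟩ <;>
  rw [h0] at e0 <;> rw [h1] at e1 <;> rw [h2] at e2 <;>
  obtain rfl : t = t' := (baryD_inj (delta_ext_fin (by linarith) (by linarith) (by linarith))) <;>
  rw [hτ] <;> try simp only [← mul_assoc, mul_one]
  · rw [flag_step0 D _ _ _ (by linarith)]
  · rw [flag_step1 D _ _ _ (by linarith)]
  · rw [flag_step1 D _ _ _ (by linarith), flag_step0 D _ _ _ (by linarith)]
  · rw [flag_step0 D _ _ _ (by linarith), flag_step1 D _ _ _ (by linarith)]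
  · rw [flag_step0 D _ _ _ (by linarith), flag_step1 D _ _ _ (by linarith),
      flag_step0 D _ _ _ (by linarith)]

theorem flagMap_surjective : Function.Surjective (flagMap D) := by
  rintro ⟨i, x⟩
  obtain ⟨σ, hσ⟩ := exists_sort x.1
  obtain ⟨t, _, ht⟩ := flagMap_of_sorted D i x σ hσ
  exact ⟨_, ht⟩

/-- The map from the coloured model to the glued space. -/
def gemToGlue : GemSpace (flagInv D) → GlueSpace D :=
  Quot.lift (fun x => Quot.mk _ (flagMap D x)) (by
    rintro ⟨⟨i, σ⟩, t⟩ _ ⟨k, hk, rfl⟩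
    dsimp only at hk
    fin_cases k
    · have hk : t.1 0 = 0 := hk
      have hw : ∀ k, (baryD t).1 (Equiv.swap (0 : Fin 3) 1 k) = (baryD t).1 k := by
        have e : (baryD t).1 0 = (baryD t).1 1 := by
          show t.1 0 + t.1 1 / 2 + t.1 2 / 3 = t.1 1 / 2 + t.1 2 / 3
          rw [hk]; ring
        intro k
        fin_cases k
        · exact e.symm
        · exact e
        · rfl
      congr 1
      apply glueTotal_ext
      · rfl
      · funext k
        exact (hw (σ.symm k)).symm
    · have hk : t.1 1 = 0 := hk
      have hw : ∀ k, (baryD t).1 (Equiv.swap (1 : Fin 3) 2 k) = (baryD t).1 k := by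
        have e : (baryD t).1 1 = (baryD t).1 2 := by
          show t.1 1 / 2 + t.1 2 / 3 = t.1 2 / 3
          rw [hk]; ring
        intro k
        fin_cases k
        · rfl
        · exact e.symm
        · exact e
      congr 1
      apply glueTotal_ext
      · rfl
      · funext k
        exact (hw (σ.symm k)).symm
    · have hk : t.1 2 = 0 := hk
      apply Quot.sound
      refine ⟨σ 2, ?_, rfl, rfl⟩
      show (baryD t).1 (σ.symm (σ 2)) = 0
      rw [Equiv.symm_apply_apply]
      show t.1 2 / 3 = 0
      rw [hk]; ring)

theorem gemToGlue_injective : Function.Injective (gemToGlue D) := by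
  let s : GlueTotal D → Σ _ : TFlag D, Delta 2 := fun p => (flagMap_surjective D p).choose
  have hs : ∀ p, flagMap D (s p) = p := fun p => (flagMap_surjective D p).choose_spec
  have huniq : ∀ x y : (Σ _ : TFlag D, Delta 2), flagMap D x = flagMap D y →
      (Quot.mk _ x : GemSpace (flagInv D)) = Quot.mk _ y := by
    rintro ⟨⟨i, σ⟩, t⟩ ⟨⟨j, σ'⟩, t'⟩ h
    have h1 : i = j := congrArg Sigma.fst h
    subst h1
    apply flag_unique D i σ σ' t t'
    exact congrArg (fun p : GlueTotal D => p.2.1) h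
  let g : GlueSpace D → GemSpace (flagInv D) := Quot.lift (fun p => Quot.mk _ (s p)) (by
    rintro ⟨i, x⟩ ⟨j, y⟩ ⟨k, hk, h1, h2⟩
    dsimp only at hk h1 h2
    subst h1
    obtain ⟨σ, hσ, hsort⟩ := exists_sort_last x.1 k (fun l => by rw [hk]; exact x.2.1 l)
    obtain ⟨t, ht, hx⟩ := flagMap_of_sorted D i x σ hsort
    have ht2 : t.1 2 = 0 := by
      have h3 : t.1 2 / 3 = x.1 (σ 2) := congrFun ht 2
      rw [hσ, hk] at h3
      linarith
    have e1 := huniq (s ⟨i, x⟩) ⟨(i, σ), t⟩ ((hs _).trans hx.symm)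
    have e2 : flagMap D ⟨flagInv D 2 (i, σ), t⟩ = ⟨(D.P (i, k)).1, y⟩ := by
      apply glueTotal_ext
      · show (D.P (i, σ 2)).1 = _
        rw [hσ]
      · show (baryD t).1 ∘ (D.glue (i, σ 2) * σ).symm = y.1
        rw [h2, ht, hσ]
        funext l
        show x.1 (σ (σ.symm ((D.glue (i, k)).symm l))) = x.1 ((D.glue (i, k)).symm l)
        rw [Equiv.apply_symm_apply]
    have e3 := huniq (s ⟨(D.P (i, k)).1, y⟩) _ ((hs _).trans e2.symm)
    have e4 := gmk_step (flagInv D) (i, σ) t 2 ht2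
    exact e1.trans (e4.symm.trans e3.symm))
  have hg : ∀ z, g (gemToGlue D z) = z := by
    rintro ⟨x⟩
    exact huniq _ _ (hs _)
  exact Function.LeftInverse.injective hg

theorem gemToGlue_homeo : Nonempty (GemSpace (flagInv D) ≃ₜ GlueSpace D) := by
  have := D.fintypeI
  have hfq : Topology.IsQuotientMap (flagMap D) :=
    (continuous_flagMap D).isClosedMap.isQuotientMap (continuous_flagMap D) (flagMap_surjective D)
  have hq : Topology.IsQuotientMap (gemToGlue D ∘ Quot.mk (gemRel (flagInv D))) :=
    (isQuotientMap_quot_mk (r := glueRel D)).comp hfq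
  have hc : Continuous (gemToGlue D) := by
    rw [isQuotientMap_quot_mk.continuous_iff]
    exact hq.continuous
  have hq2 : Topology.IsQuotientMap (gemToGlue D) := hq.of_comp continuous_quot_mk hc
  exact ⟨(Equiv.ofBijective _ ⟨gemToGlue_injective D, hq2.surjective⟩).toHomeomorph
    fun _ => hq2.isOpen_preimage⟩

end Subdivision

theorem LocEuclidean.congr {Y Z : Type} [TopologicalSpace Y] [TopologicalSpace Z] (n : ℕ)
    (e : Y ≃ₜ Z) (h : LocEuclidean n Y) : LocEuclidean n Z := by
  intro z
  obtain ⟨U, hU, hz, ⟨φ⟩⟩ := h (e.symm z)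
  refine ⟨e '' U, e.isOpenMap U hU, ⟨_, hz, by simp⟩, ⟨(e.image U).symm.trans φ⟩⟩

/-- In dimension 2, the space obtained from any finite collection of triangles by
glueing their edges in pairs via simplicial identifications is always a closed surface:
compact, Hausdorff, and locally homeomorphic to ℝ². -/
theorem dim2_always_closed_surface (D : GlueingDatum 2) :
    CompactSpace (GlueSpace D) ∧ T2Space (GlueSpace D) ∧
      LocEuclidean 2 (GlueSpace D) := by
  have := D.fintypeI
  obtain ⟨e⟩ := gemToGlue_homeo D
  have ht2 : T2Space (GemSpace (flagInv D)) := gem_t2 _ (flagInv_invol D)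
  exact ⟨inferInstance, e.t2Space, LocEuclidean.congr 2 e
    (gem_locEuclidean _ (flagInv_invol D) (flagInv_ne D))⟩
end
end
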